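/- (Sampling theorem.) There exists a constant C > 0 such that for every integer k ≥ 3 and every orderon W the following holds. With respect to the product Lebesgue probability measure on [0,1]^k × [0,1]^k × [0,1]^{k(k−1)/2}, the measure of the set of points (z,y,r) for which d△(W, W_{G(z,y,r;W)}) > C·(log log k / log k)^{1/3} is at most C·exp(−√k/C). -/

import Mathlib

open MeasureTheory Real Filter
open scoped ENNReal Classical

noncomputable section

/-- The unit interval `[0,1]` as a subtype of `ℝ`. -/
abbrev UI : Type := Set.Icc (0:ℝ) 1

/-- The unit square `[0,1]²`. -/
abbrev USq : Type := UI × UI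

/-- An orderon: a symmetric measurable function `([0,1]²)² → [0,1]`. -/
def IsOrderon (W : USq → USq → ℝ) : Prop :=
  Measurable (Function.uncurry W) ∧ (∀ u v, W u v ∈ Set.Icc (0:ℝ) 1) ∧
    ∀ u v, W u v = W v u

/-- The (unordered) cut norm: `sup_{S,T} |∫_{S×T} W|` over measurable `S,T ⊆ [0,1]²`. -/
def cutNorm (W : USq → USq → ℝ) : ℝ :=
  sSup {x | ∃ S T : Set USq, MeasurableSet S ∧ MeasurableSet T ∧
    x = |∫ p in S ×ˢ T, W p.1 p.2|}

/-- A measure-preserving bijection of `[0,1]²` with measure-preserving inverse. -/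
def IsMPB (f : USq → USq) : Prop :=
  MeasurePreserving f volume volume ∧
  ∃ g : USq → USq, MeasurePreserving g volume volume ∧
    Function.LeftInverse g f ∧ Function.RightInverse g f

/-- `Shift(f) = sup_{(x,a)} |x - π₁(f(x,a))|`. -/
def shiftOf (f : USq → USq) : ℝ := ⨆ u : USq, |(u.1 : ℝ) - ((f u).1 : ℝ)|

/-- The cut-shift distance `d△(W,U) = inf_f (Shift(f) + ‖W - U^f‖_□)`. -/
def csDist (W U : USq → USq → ℝ) : ℝ :=
  sInf {x | ∃ f : USq → USq, IsMPB f ∧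
    x = shiftOf f + cutNorm (fun u v => W u v - U (f u) (f v))}

/-- `Q_n(z) = ⌈nz⌉` for `z ∈ (0,1]`, and `Q_n(0) = 1`. -/
def Qn (n : ℕ) (x : ℝ) : ℕ := max 1 ⌈(n : ℝ) * x⌉₊

/-- The naive `n`-block orderon of a weighted ordered graph `G : [n]² → [0,1]`
(given as a function `ℕ → ℕ → ℝ`, 1-indexed). -/
def blockOrderon (n : ℕ) (G : ℕ → ℕ → ℝ) : USq → USq → ℝ :=
  fun u v => G (Qn n (u.1 : ℝ)) (Qn n (v.1 : ℝ))

/-- The (1-indexed, real-valued) adjacency function of a simple ordered graph on `[n]`. -/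
def graphAdjFun {n : ℕ} (G : SimpleGraph (Fin n)) : ℕ → ℕ → ℝ :=
  fun i j => if h : i - 1 < n ∧ j - 1 < n then
    (if G.Adj ⟨i - 1, h.1⟩ ⟨j - 1, h.2⟩ then 1 else 0) else 0

/-- The naive block orderon `W_G` representing a simple ordered graph `G` on `[n]`. -/
def graphOrderon {n : ℕ} (G : SimpleGraph (Fin n)) : USq → USq → ℝ :=
  blockOrderon n (graphAdjFun G)

/-- Index type for the `k(k-1)/2` coordinates `r_{ij}`, `i < j`. -/
abbrev Pairs (k : ℕ) := {p : Fin k × Fin k // p.1 < p.2}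

/-- The random ordered graph `G(z,y,r;W)` on `[k]` sampled from an orderon `W`:
sort `z` nondecreasingly via the permutation `σ = Tuple.sort z`, set
`X_i = z_{σ(i)}`, `Y_i = y_{σ(i)}`, and put an edge `{i,j}` (for `i < j`) iff
`r_{ij} ≤ W((X_i,Y_i),(X_j,Y_j))`. -/
def sampleSG (k : ℕ) (W : USq → USq → ℝ) (z y : Fin k → UI) (r : Pairs k → UI) :
    SimpleGraph (Fin k) :=
  SimpleGraph.fromRel (fun a b =>
    ∃ h : a < b, (r ⟨(a, b), h⟩ : ℝ) ≤
      W (z (Tuple.sort (fun t => (z t : ℝ)) a), y (Tuple.sort (fun t => (z t : ℝ)) a))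
        (z (Tuple.sort (fun t => (z t : ℝ)) b), y (Tuple.sort (fun t => (z t : ℝ)) b)))

/-- Hoeffding's inequality on a product space, for non-identical summands bounded by `B`. -/
lemma hoeffding_pi {ι X : Type*} [Fintype ι] [MeasurableSpace X] (μ : Measure X)
    [IsProbabilityMeasure μ] (h : ι → X → ℝ) (hm : ∀ i, Measurable (h i)) {B : ℝ} (hB0 : 0 < B)
    (hB : ∀ i ξ, |h i ξ| ≤ B) {n : ℝ} (hn : (Fintype.card ι : ℝ) ≤ n) {t : ℝ} (ht : 0 < t) :
    Measure.pi (fun _ : ι => μ) {x | t ≤ ∑ i, (h i (x i) - ∫ ξ, h i ξ ∂μ)} ≤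
      ENNReal.ofReal (Real.exp (-t ^ 2 / (2 * (n * B ^ 2)))) := by
  rcases isEmpty_or_nonempty ι with hι | hι
  · have : {x : ι → X | t ≤ ∑ i, (h i (x i) - ∫ ξ, h i ξ ∂μ)} = ∅ := by
      ext x; simp [ht]
    rw [this]; simp
  have hcard : (0 : ℝ) < Fintype.card ι := by exact_mod_cast Fintype.card_pos
  have hind : ProbabilityTheory.iIndepFun
      (fun i (ω : ι → X) => h i (ω i) - ∫ ξ, h i ξ ∂μ) (Measure.pi fun _ => μ) :=
    ProbabilityTheory.iIndepFun_pi (X := fun i ξ => h i ξ - ∫ ξ, h i ξ ∂μ)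
      (fun i => ((hm i).sub_const _).aemeasurable)
  have hsub : ∀ i ∈ (Finset.univ : Finset ι), ProbabilityTheory.HasSubgaussianMGF
      (fun (ω : ι → X) => h i (ω i) - ∫ ξ, h i ξ ∂μ) ((‖B - (-B)‖₊ / 2) ^ 2)
      (Measure.pi fun _ => μ) := by
    intro i _
    have hinteg : ∫ ω : ι → X, h i (ω i) ∂(Measure.pi fun _ => μ) = ∫ ξ, h i ξ ∂μ := by
      have hp := measurePreserving_eval (fun _ : ι => μ) i
      have h1 := integral_map (μ := Measure.pi fun _ : ι => μ) hp.measurable.aemeasurable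
        (hm i).aestronglyMeasurable
      rw [hp.map_eq] at h1
      exact h1.symm
    have := ProbabilityTheory.hasSubgaussianMGF_of_mem_Icc (μ := Measure.pi fun _ : ι => μ)
      (X := fun ω : ι → X => h i (ω i)) (a := -B) (b := B)
      ((hm i).comp (measurable_pi_apply i)).aemeasurable
      (ae_of_all _ fun ω => abs_le.1 (hB i (ω i)))
    rwa [hinteg] at this
  have key := ProbabilityTheory.HasSubgaussianMGF.measure_sum_ge_le_of_iIndepFun hind hsub ht.le
  have hc : ((∑ _i : ι, (‖B - (-B)‖₊ / 2) ^ 2 : NNReal) : ℝ) = Fintype.card ι * B ^ 2 := by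
    push_cast
    rw [Finset.sum_const, Finset.card_univ, nsmul_eq_mul]
    congr 2
    rw [Real.norm_eq_abs, abs_of_pos (by linarith)]; ring
  rw [hc] at key
  rw [← ENNReal.ofReal_toReal (measure_ne_top (Measure.pi fun _ : ι => μ) _)]
  refine ENNReal.ofReal_le_ofReal (key.trans (Real.exp_le_exp.2 ?_))
  rw [neg_div, neg_div, neg_le_neg_iff]
  apply div_le_div_of_nonneg_left (by positivity) (by positivity)
  have : 0 ≤ B ^ 2 := by positivity
  nlinarith

/-- A fibrewise bound on sections bounds the measure of a measurable set in a product. -/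
lemma measure_prod_le_of_sections {X Y : Type*} [MeasurableSpace X] [MeasurableSpace Y]
    (μ : Measure X) (ν : Measure Y) [IsProbabilityMeasure μ] [IsProbabilityMeasure ν]
    {E : Set (X × Y)} (hE : MeasurableSet E) {p : ℝ≥0∞} (hp : ∀ x, ν (Prod.mk x ⁻¹' E) ≤ p) :
    (μ.prod ν) E ≤ p := by
  rw [Measure.prod_apply hE]
  calc ∫⁻ x, ν (Prod.mk x ⁻¹' E) ∂μ ≤ ∫⁻ _, p ∂μ := lintegral_mono hp
    _ = p := by simp

/-- Hoeffding's inequality, conditionally on the coordinates in `D`. -/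
lemma hoeffding_conditional {X : Type*} [MeasurableSpace X] [Nonempty X] (μ : Measure X)
    [IsProbabilityMeasure μ] {k : ℕ} (D : Finset (Fin k)) (h : (Fin k → X) → X → ℝ)
    (hm : Measurable (Function.uncurry h))
    (hdep : ∀ x x', (∀ i ∈ D, x i = x' i) → h x = h x') {B : ℝ} (hB0 : 0 < B)
    (hB : ∀ x ξ, |h x ξ| ≤ B) {t : ℝ} (ht : 0 < t) :
    Measure.pi (fun _ : Fin k => μ) {x | t ≤ ∑ j ∈ Dᶜ, (h x (x j) - ∫ ξ, h x ξ ∂μ)} ≤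
      ENNReal.ofReal (Real.exp (-t ^ 2 / (2 * (k * B ^ 2)))) := by
  set E : Set (Fin k → X) := {x | t ≤ ∑ j ∈ Dᶜ, (h x (x j) - ∫ ξ, h x ξ ∂μ)} with hEdef
  have hEm : MeasurableSet E := by
    refine measurableSet_le measurable_const ?_
    refine Finset.measurable_fun_sum _ fun j _ => ?_
    refine Measurable.sub ?_ ?_
    · exact hm.comp (measurable_id.prodMk (measurable_pi_apply j))
    · exact (hm.stronglyMeasurable.integral_prod_right (ν := μ)).measurable
  have hmp := measurePreserving_piEquivPiSubtypeProd (fun _ : Fin k => μ) (fun i => i ∈ D)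
  set e := MeasurableEquiv.piEquivPiSubtypeProd (fun _ : Fin k => X) (fun i => i ∈ D)
  have hEe : E = e ⁻¹' (e.symm ⁻¹' E) := by
    ext x; simp
  rw [hEe, hmp.measure_preimage (e.symm.measurable hEm).nullMeasurableSet]
  refine measure_prod_le_of_sections _ _ (e.symm.measurable hEm) fun d => ?_
  obtain ⟨x0⟩ : Nonempty X := inferInstance
  set xd : Fin k → X := e.symm (d, fun _ => x0) with hxd
  have hD : ∀ ω, h (e.symm (d, ω)) = h xd := by
    intro ω
    refine hdep _ _ fun i hi => ?_
    simp [e, xd, MeasurableEquiv.piEquivPiSubtypeProd, Equiv.piEquivPiSubtypeProd, hi]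
  have hset : Prod.mk d ⁻¹' (e.symm ⁻¹' E) =
      {ω : {i // i ∉ D} → X | t ≤ ∑ j, (h xd (ω j) - ∫ ξ, h xd ξ ∂μ)} := by
    ext ω
    simp only [Set.mem_preimage, hEdef, Set.mem_ofPred_eq, hD]
    have hs : ∑ j ∈ Dᶜ, (h xd (e.symm (d, ω) j) - ∫ ξ, h xd ξ ∂μ) =
        ∑ j : {i // i ∉ D}, (h xd (e.symm (d, ω) j) - ∫ ξ, h xd ξ ∂μ) :=
      Finset.sum_subtype _ (by simp) _
    rw [hs]
    have : ∀ j : {i // i ∉ D}, e.symm (d, ω) j = ω j := by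
      intro j
      simp [e, MeasurableEquiv.piEquivPiSubtypeProd, Equiv.piEquivPiSubtypeProd, j.2]
    simp only [this]
  rw [hset]
  refine hoeffding_pi μ (fun _ : {i // i ∉ D} => h xd)
    (fun _ => hm.comp measurable_prodMk_left) hB0 (fun _ ξ => hB xd ξ) ?_ ht
  exact_mod_cast (Fintype.card_subtype_le (fun i : Fin k => i ∉ D)).trans (by simp)

/-- Empirical approximation: some `q` columns of a bounded matrix nearly average to the mean. -/
lemma exists_column_sample {k : ℕ} (hk : 0 < k) (v : Fin k → Fin k → ℝ) {B : ℝ}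
    (hB : ∀ i j, |v i j| ≤ B) (q : ℕ) :
    ∃ Q : Fin q → Fin k,
      ∑ i, (∑ t, v i (Q t) - q / k * ∑ j, v i j) ^ 2 ≤ q * k * (2 * B) ^ 2 := by
  have hk' : (0 : ℝ) < k := by exact_mod_cast hk
  induction q with
  | zero => exact ⟨Fin.elim0, by simp⟩
  | succ q ih =>
    obtain ⟨Q, hQ⟩ := ih
    set w : Fin k → ℝ := fun i => ∑ t, v i (Q t) - q / k * ∑ j, v i j with hw
    set d : Fin k → Fin k → ℝ := fun i j => v i j - 1 / k * ∑ j, v i j with hd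
    have hd0 : ∀ i, ∑ j, d i j = 0 := by
      intro i
      simp only [hd, Finset.sum_sub_distrib, Finset.sum_const, Finset.card_univ, Fintype.card_fin,
        nsmul_eq_mul]
      field_simp
      ring
    have hdB : ∀ i j, |d i j| ≤ 2 * B := by
      intro i j
      have h1 : |∑ j, v i j| ≤ k * B := by
        refine (Finset.abs_sum_le_sum_abs _ _).trans ?_
        refine (Finset.sum_le_sum fun j _ => hB i j).trans ?_
        simp
      have h2 : |1 / (k : ℝ) * ∑ j, v i j| ≤ B := by
        rw [abs_mul, abs_of_pos (by positivity)]
        calc 1 / (k : ℝ) * |∑ j, v i j| ≤ 1 / k * (k * B) := by gcongr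
          _ = B := by field_simp
      calc |d i j| ≤ |v i j| + |1 / (k : ℝ) * ∑ j, v i j| := abs_sub _ _
        _ ≤ 2 * B := by linarith [hB i j]
    obtain ⟨j, -, hj⟩ : ∃ j ∈ (Finset.univ : Finset (Fin k)), ∑ i, w i * d i j ≤ 0 := by
      apply Finset.exists_le_of_sum_le ⟨⟨0, hk⟩, Finset.mem_univ _⟩
      rw [Finset.sum_comm]
      simp [← Finset.mul_sum, hd0]
    refine ⟨Fin.cons j Q, ?_⟩
    have hterm : ∀ i, (∑ t, v i ((Fin.cons j Q : Fin (q + 1) → Fin k) t)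
        - ((q + 1 : ℕ) : ℝ) / k * ∑ j, v i j) = w i + d i j := by
      intro i
      rw [Fin.sum_univ_succ]
      simp only [Fin.cons_zero, Fin.cons_succ, hw, hd]
      push_cast
      ring
    simp only [hterm]
    calc ∑ i, (w i + d i j) ^ 2 = ∑ i, (w i) ^ 2 + 2 * ∑ i, w i * d i j + ∑ i, (d i j) ^ 2 := by
          rw [Finset.mul_sum, ← Finset.sum_add_distrib, ← Finset.sum_add_distrib]
          exact Finset.sum_congr rfl fun i _ => by ring
      _ ≤ q * k * (2 * B) ^ 2 + 2 * 0 + ∑ _i : Fin k, (2 * B) ^ 2 := by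
          refine add_le_add (add_le_add hQ (by linarith)) (Finset.sum_le_sum fun i _ => ?_)
          exact sq_le_sq' (abs_le.1 (hdB i j)).1 (abs_le.1 (hdB i j)).2
      _ = ((q + 1 : ℕ) : ℝ) * k * (2 * B) ^ 2 := by
          simp; ring

/-- The rows of `u` on which the columns `Q t`, `t ∈ R`, have positive sum. -/
def positiveRows {k q : ℕ} (u : Fin k → Fin k → ℝ) (Q : Fin q → Fin k) (R : Finset (Fin q)) :
    Finset (Fin k) :=
  Finset.univ.filter fun i => 0 < ∑ t ∈ R, u i (Q t)

/-- A set of rows may be replaced by one determined by few columns. -/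
lemma exists_positiveRows {k : ℕ} (hk : 0 < k) (u : Fin k → Fin k → ℝ) {B : ℝ} (hB0 : 0 ≤ B)
    (hB : ∀ i j, |u i j| ≤ B) {p : ℕ} (hp : 0 < p) (S T : Finset (Fin k)) :
    ∃ (Q : Fin (p * p) → Fin k) (R : Finset (Fin (p * p))),
      ∑ i ∈ S, ∑ j ∈ T, u i j ≤
        ∑ i ∈ positiveRows u Q R, ∑ j ∈ T, u i j + 2 * B * k ^ 2 / p := by
  have hk' : (0 : ℝ) < k := by exact_mod_cast hk
  have hp' : (0 : ℝ) < p := by exact_mod_cast hp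
  obtain ⟨Q, hQ⟩ := exists_column_sample hk (fun i j => if j ∈ T then u i j else 0) (B := B)
    (by intro i j; split_ifs <;> simp [hB, hB0]) (p * p)
  refine ⟨Q, Finset.univ.filter fun t => Q t ∈ T, ?_⟩
  set r : Fin k → ℝ := fun i => ∑ j ∈ T, u i j with hr
  set e : Fin k → ℝ := fun i => ∑ t ∈ Finset.univ.filter (fun t => Q t ∈ T), u i (Q t) with he
  have hr' : ∀ i, ∑ j, (if j ∈ T then u i j else 0) = r i := fun i => by simp [hr]
  have he' : ∀ i, ∑ t, (if Q t ∈ T then u i (Q t) else 0) = e i := fun i => by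
    simp [he, Finset.sum_filter]
  simp only [hr', he'] at hQ
  set w : Fin k → ℝ := fun i => e i - ((p * p : ℕ) : ℝ) / k * r i with hw
  have hsum : ∑ i, |w i| ≤ 2 * B * k * p := by
    apply le_of_sq_le_sq _ (by positivity)
    have h1 := sq_sum_le_card_mul_sum_sq (s := (Finset.univ : Finset (Fin k)))
      (f := fun i => |w i|)
    simp only [sq_abs, Finset.card_univ, Fintype.card_fin] at h1
    refine h1.trans ?_
    calc (k : ℝ) * ∑ i, w i ^ 2 ≤ k * (((p * p : ℕ) : ℝ) * k * (2 * B) ^ 2) := by gcongr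
      _ = (2 * B * k * p) ^ 2 := by push_cast; ring
  have hpt : ∀ i, max (r i) 0 ≤ (if 0 < e i then r i else 0) + k / (p * p) * |w i| := by
    intro i
    have h1 : k / ((p : ℝ) * p) * |w i| = |k / ((p : ℝ) * p) * e i - r i| := by
      have : k / ((p : ℝ) * p) * e i - r i = k / ((p : ℝ) * p) * w i := by
        simp only [hw]; push_cast; field_simp
      rw [this, abs_mul, abs_of_pos (by positivity : 0 < k / ((p : ℝ) * p))]
    rw [h1]
    have hc : 0 < k / ((p : ℝ) * p) := by positivity
    have ha := le_abs_self (k / ((p : ℝ) * p) * e i - r i)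
    have hb := neg_le_abs (k / ((p : ℝ) * p) * e i - r i)
    split_ifs with h
    · have := mul_pos hc h
      apply max_le <;> linarith [abs_nonneg (k / ((p : ℝ) * p) * e i - r i)]
    · have := mul_nonneg hc.le (sub_nonneg.2 (not_lt.1 h))
      apply max_le <;> nlinarith [abs_nonneg (k / ((p : ℝ) * p) * e i - r i)]
  calc ∑ i ∈ S, r i ≤ ∑ i ∈ S, max (r i) 0 := Finset.sum_le_sum fun i _ => le_max_left _ _
    _ ≤ ∑ i, max (r i) 0 :=
        Finset.sum_le_sum_of_subset_of_nonneg (Finset.subset_univ _) fun i _ _ => le_max_right _ _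
    _ ≤ ∑ i, ((if 0 < e i then r i else 0) + k / (p * p) * |w i|) :=
        Finset.sum_le_sum fun i _ => hpt i
    _ = ∑ i ∈ positiveRows u Q (Finset.univ.filter fun t => Q t ∈ T), r i
          + k / (p * p) * ∑ i, |w i| := by
        rw [Finset.sum_add_distrib, Finset.mul_sum, positiveRows, Finset.sum_filter]
    _ ≤ _ := by
        gcongr
        calc (k : ℝ) / (p * p) * ∑ i, |w i| ≤ k / (p * p) * (2 * B * k * p) := by gcongr
          _ = 2 * B * k ^ 2 / p := by field_simp

/-- Any rectangle sum is nearly bounded by a sum over sets determined by few rows and columns. -/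
lemma exists_positive_rectangle {k : ℕ} (hk : 0 < k) (u : Fin k → Fin k → ℝ) {B : ℝ} (hB0 : 0 ≤ B)
    (hB : ∀ i j, |u i j| ≤ B) {p : ℕ} (hp : 0 < p) (S T : Finset (Fin k)) :
    ∃ (Q Q' : Fin (p * p) → Fin k) (R R' : Finset (Fin (p * p))),
      ∑ i ∈ S, ∑ j ∈ T, u i j ≤
        ∑ i ∈ positiveRows u Q R, ∑ j ∈ positiveRows (fun a b => u b a) Q' R', u i j
          + 4 * B * k ^ 2 / p := by
  obtain ⟨Q, R, h⟩ := exists_positiveRows hk u hB0 hB hp S T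
  obtain ⟨Q', R', h'⟩ := exists_positiveRows hk (fun a b => u b a) hB0 (fun i j => hB j i) hp T
    (positiveRows u Q R)
  refine ⟨Q, Q', R, R', h.trans ?_⟩
  rw [Finset.sum_comm] at h'
  rw [Finset.sum_comm (s := positiveRows u Q R) (t := positiveRows (fun a b => u b a) Q' R')]
  have : 4 * B * k ^ 2 / (p : ℝ) = 2 * B * k ^ 2 / p + 2 * B * k ^ 2 / p := by ring
  linarith

/-- A union of finitely many events of probability at most `p`. -/
lemma measure_iUnion_le_card {ι Ω : Type*} [Fintype ι] [MeasurableSpace Ω] (μ : Measure Ω)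
    (E : ι → Set Ω) {p : ℝ} (hE : ∀ i, μ (E i) ≤ ENNReal.ofReal p) :
    μ (⋃ i, E i) ≤ ENNReal.ofReal (Fintype.card ι * p) := by
  calc μ (⋃ i, E i) ≤ ∑ i, μ (E i) := measure_iUnion_fintype_le μ E
    _ ≤ ∑ _i : ι, ENNReal.ofReal p := Finset.sum_le_sum fun i _ => hE i
    _ = ENNReal.ofReal (Fintype.card ι * p) := by
      rw [Finset.sum_const, Finset.card_univ, nsmul_eq_mul,
        ENNReal.ofReal_mul (by positivity), ENNReal.ofReal_natCast]

lemma sum_le_of_sum_compl_lt {k : ℕ} (a : Fin k → ℝ) {B m τ : ℝ} (ha : ∀ j, |a j| ≤ B)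
    (hm : |m| ≤ B) (D : Finset (Fin k)) (h : ∑ j ∈ Dᶜ, (a j - m) < τ) :
    ∑ j, a j ≤ τ + k * m + 2 * D.card * B := by
  have h1 : ∑ j, a j = ∑ j ∈ D, (a j - m) + ∑ j ∈ Dᶜ, (a j - m) + k * m := by
    rw [Finset.sum_add_sum_compl, Finset.sum_sub_distrib]; simp
  have h2 : ∑ j ∈ D, (a j - m) ≤ ∑ _j ∈ D, 2 * B :=
    Finset.sum_le_sum fun j _ => by linarith [(abs_le.1 (ha j)).2, (abs_le.1 hm).1]
  rw [Finset.sum_const, nsmul_eq_mul] at h2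
  linarith

lemma abs_integral_le_of_abs_le {X : Type*} [MeasurableSpace X] (μ : Measure X)
    [IsProbabilityMeasure μ] {f : X → ℝ} {B : ℝ} (hB : ∀ x, |f x| ≤ B) : |∫ x, f x ∂μ| ≤ B := by
  have := norm_integral_le_of_norm_le_const (μ := μ) (f := f) (C := B) (ae_of_all _ hB)
  simpa using this

/-- With high probability all rectangle sums of a sampled kernel are bounded by the largest
rectangle integral of the kernel, up to a small error. -/
lemma sample_rectangle_le {X : Type*} [MeasurableSpace X] [Nonempty X] (μ : Measure X)
    [IsProbabilityMeasure μ] (U : X → X → ℝ) (hU : Measurable (Function.uncurry U)) {B κ lam : ℝ}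
    (hB0 : 0 < B) (hB : ∀ ξ ζ, |U ξ ζ| ≤ B)
    (hκ : ∀ S T : Set X, MeasurableSet S → MeasurableSet T →
      ∫ z in S ×ˢ T, U z.1 z.2 ∂(μ.prod μ) ≤ κ) (hlam : 0 < lam)
    {k p : ℕ} (hk : 0 < k) (hp : 0 < p) :
    ∃ E : Set (Fin k → X), Measure.pi (fun _ => μ) E ≤
        ENNReal.ofReal (((k : ℝ) ^ (p * p) * 2 ^ (p * p)) ^ 2 * ((k + 1) *
          Real.exp (-(k * lam) ^ 2 / (2 * (k * B ^ 2))))) ∧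
      ∀ x ∉ E, ∀ S T : Finset (Fin k), ∑ i ∈ S, ∑ j ∈ T, U (x i) (x j) ≤
        k ^ 2 * (κ + 2 * lam) + k * B * (8 * p ^ 2 + 2) + 4 * B * k ^ 2 / p := by
  have hk' : (0 : ℝ) < k := by exact_mod_cast hk
  let J := ((Fin (p * p) → Fin k) × Finset (Fin (p * p))) ×
    ((Fin (p * p) → Fin k) × Finset (Fin (p * p)))
  let row : J → (Fin k → X) → X → ℝ := fun c x ξ =>
    if 0 < ∑ t ∈ c.1.2, U ξ (x (c.1.1 t)) then 1 else 0
  let col : J → (Fin k → X) → X → ℝ := fun c x ζ =>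
    if 0 < ∑ t ∈ c.2.2, U (x (c.2.1 t)) ζ then 1 else 0
  let D : J → Finset (Fin k) := fun c =>
    Finset.univ.image c.1.1 ∪ Finset.univ.image c.2.1
  have hev : ∀ j, Measurable (fun z : (Fin k → X) × X => (z.1 j, z.2)) := fun j =>
    ((measurable_pi_apply j).comp measurable_fst).prodMk measurable_snd
  have hrow01 : ∀ c x ξ, 0 ≤ row c x ξ ∧ row c x ξ ≤ 1 := by
    intro c x ξ; simp only [row]; split_ifs <;> norm_num
  have hcol01 : ∀ c x ξ, 0 ≤ col c x ξ ∧ col c x ξ ≤ 1 := by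
    intro c x ξ; simp only [col]; split_ifs <;> norm_num
  have hrowm : ∀ c, Measurable (Function.uncurry (row c)) := by
    intro c
    refine Measurable.ite (measurableSet_lt measurable_const ?_) measurable_const measurable_const
    refine Finset.measurable_fun_sum _ fun t _ => ?_
    exact hU.comp (measurable_snd.prodMk ((measurable_pi_apply _).comp measurable_fst))
  have hcolm : ∀ c, Measurable (Function.uncurry (col c)) := by
    intro c
    refine Measurable.ite (measurableSet_lt measurable_const ?_) measurable_const measurable_const
    refine Finset.measurable_fun_sum _ fun t _ => ?_
    exact hU.comp (hev _)
  let φ : J → (Fin k → X) → X → ℝ := fun c x ξ => ∫ ζ, col c x ζ * U ξ ζ ∂μ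
  have hcU : ∀ c x ξ ζ, |col c x ζ * U ξ ζ| ≤ B := by
    intro c x ξ ζ
    rw [abs_mul, abs_of_nonneg (hcol01 c x ζ).1]
    calc _ ≤ 1 * B := mul_le_mul (hcol01 c x ζ).2 (hB ξ ζ) (abs_nonneg _) zero_le_one
      _ = B := one_mul B
  have hφB : ∀ c x ξ, |φ c x ξ| ≤ B := by
    intro c x ξ
    exact abs_integral_le_of_abs_le μ (hcU c x ξ)
  have hφm : ∀ c, Measurable (Function.uncurry (φ c)) := by
    intro c
    have : Measurable (fun z : ((Fin k → X) × X) × X => col c z.1.1 z.2 * U z.1.2 z.2) :=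
      ((hcolm c).comp ((measurable_fst.comp measurable_fst).prodMk measurable_snd)).mul
        (hU.comp ((measurable_snd.comp measurable_fst).prodMk measurable_snd))
    exact (this.stronglyMeasurable.integral_prod_right (ν := μ)).measurable
  let h1 : J → Fin k → (Fin k → X) → X → ℝ := fun c i x ζ => col c x ζ * U (x i) ζ
  let h2 : J → (Fin k → X) → X → ℝ := fun c x ξ => row c x ξ * φ c x ξ
  have hh2B : ∀ c x ξ, |h2 c x ξ| ≤ B := by
    intro c x ξ
    simp only [h2]
    rw [abs_mul, abs_of_nonneg (hrow01 c x ξ).1]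
    calc _ ≤ 1 * B := mul_le_mul (hrow01 c x ξ).2 (hφB c x ξ) (abs_nonneg _) zero_le_one
      _ = B := one_mul B
  have hh2int : ∀ c x, ∫ ξ, h2 c x ξ ∂μ ≤ κ := by
    intro c x
    have hS : MeasurableSet {ξ | 0 < ∑ t ∈ c.1.2, U ξ (x (c.1.1 t))} :=
      measurableSet_lt measurable_const (Finset.measurable_fun_sum _ fun t _ =>
        hU.comp (measurable_id.prodMk measurable_const))
    have hT : MeasurableSet {ζ | 0 < ∑ t ∈ c.2.2, U (x (c.2.1 t)) ζ} :=
      measurableSet_lt measurable_const (Finset.measurable_fun_sum _ fun t _ =>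
        hU.comp (measurable_const.prodMk measurable_id))
    refine le_trans (le_of_eq ?_) (hκ _ _ hS hT)
    rw [← integral_indicator (hS.prod hT), integral_prod]
    · refine integral_congr_ae (ae_of_all _ fun ξ => ?_)
      simp only [h2, φ, row]
      split_ifs with hc
      · rw [one_mul]
        refine integral_congr_ae (ae_of_all _ fun ζ => ?_)
        simp only [col, Set.indicator_apply, Set.mem_prod, Set.mem_ofPred_eq, hc, true_and]
        split_ifs <;> simp
      · rw [zero_mul]
        simp [hc]
    · refine Integrable.indicator ?_ (hS.prod hT)
      exact Integrable.of_bound hU.aestronglyMeasurable B (ae_of_all _ fun z => hB z.1 z.2)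
  let E1 : J → Fin k → Set (Fin k → X) := fun c i =>
    {x | k * lam ≤ ∑ j ∈ (insert i (D c))ᶜ, (h1 c i x (x j) - ∫ ζ, h1 c i x ζ ∂μ)}
  let E2 : J → Set (Fin k → X) := fun c =>
    {x | k * lam ≤ ∑ j ∈ (D c)ᶜ, (h2 c x (x j) - ∫ ζ, h2 c x ζ ∂μ)}
  let F : J × Option (Fin k) → Set (Fin k → X) := fun d => d.2.elim (E2 d.1) (E1 d.1)
  have hcoldep : ∀ c x x', (∀ i ∈ D c, x i = x' i) → col c x = col c x' := by
    intro c x x' hx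
    funext ζ
    have : ∀ t, x (c.2.1 t) = x' (c.2.1 t) := fun t => hx _ (by simp [D])
    simp only [col, this]
  have hrowdep : ∀ c x x', (∀ i ∈ D c, x i = x' i) → row c x = row c x' := by
    intro c x x' hx
    funext ζ
    have : ∀ t, x (c.1.1 t) = x' (c.1.1 t) := fun t => hx _ (by simp [D])
    simp only [row, this]
  have hF : ∀ d, Measure.pi (fun _ => μ) (F d) ≤
      ENNReal.ofReal (Real.exp (-(k * lam) ^ 2 / (2 * (k * B ^ 2)))) := by
    rintro ⟨c, _ | i⟩
    · refine hoeffding_conditional μ (D c) (h2 c) ((hrowm c).mul (hφm c)) ?_ hB0 (hh2B c)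
        (by positivity)
      intro x x' hx
      funext ξ
      simp only [h2, φ, hcoldep c x x' hx, hrowdep c x x' hx]
    · refine hoeffding_conditional μ (insert i (D c)) (h1 c i) ((hcolm c).mul ?_) ?_ hB0
        (fun x ζ => hcU c x (x i) ζ) (by positivity)
      · exact hU.comp (hev i)
      · intro x x' hx
        funext ξ
        simp only [h1, hcoldep c x x' (fun j hj => hx j (Finset.mem_insert_of_mem hj)),
          hx i (Finset.mem_insert_self _ _)]
  refine ⟨⋃ d, F d, (measure_iUnion_le_card _ F hF).trans (ENNReal.ofReal_le_ofReal ?_), ?_⟩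
  · refine le_of_eq ?_
    simp only [J, Fintype.card_prod, Fintype.card_option, Fintype.card_fin, Fintype.card_finset,
      Fintype.card_fun]
    push_cast
    ring
  intro x hx S T
  simp only [Set.mem_iUnion, not_exists] at hx
  obtain ⟨Q, Q', R, R', hQ⟩ := exists_positive_rectangle hk (fun i j => U (x i) (x j)) hB0.le
    (fun i j => hB _ _) hp S T
  refine hQ.trans (add_le_add ?_ le_rfl)
  let c : J := ((Q, R), (Q', R'))
  have hDc : ((D c).card : ℝ) ≤ 2 * p ^ 2 := by
    have h : (D c).card ≤ p * p + p * p := by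
      refine (Finset.card_union_le _ _).trans (add_le_add ?_ ?_) <;>
      exact Finset.card_image_le.trans (by simp)
    have : ((D c).card : ℝ) ≤ ((p * p + p * p : ℕ) : ℝ) := by exact_mod_cast h
    push_cast at this; linarith
  have hDi : ∀ i, ((insert i (D c)).card : ℝ) ≤ 2 * p ^ 2 + 1 := by
    intro i
    have : ((insert i (D c)).card : ℝ) ≤ (((D c).card + 1 : ℕ) : ℝ) := by
      exact_mod_cast Finset.card_insert_le _ _
    push_cast at this; linarith
  have hx2 : ∑ i, h2 c x (x i) ≤ k * lam + k * κ + 4 * p ^ 2 * B := by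
    have h0 : ∑ j ∈ (D c)ᶜ, (h2 c x (x j) - ∫ ζ, h2 c x ζ ∂μ) < k * lam := by
      simpa [F, E2] using hx (c, none)
    have hmB : |∫ ζ, h2 c x ζ ∂μ| ≤ B := abs_integral_le_of_abs_le μ (hh2B c x)
    have := sum_le_of_sum_compl_lt (fun i => h2 c x (x i)) (fun i => hh2B c x _) hmB (D c) h0
    have hb := mul_le_mul_of_nonneg_left (hh2int c x) hk'.le
    have hd := mul_le_mul_of_nonneg_right hDc hB0.le
    linarith
  have hx1 : ∀ i, ∑ j, h1 c i x (x j) ≤ k * lam + k * φ c x (x i) + (4 * p ^ 2 + 2) * B := by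
    intro i
    have h0 : ∑ j ∈ (insert i (D c))ᶜ, (h1 c i x (x j) - φ c x (x i)) < k * lam := by
      simpa [F, E1, φ, h1] using hx (c, some i)
    have := sum_le_of_sum_compl_lt (fun j => h1 c i x (x j)) (fun j => hcU c x _ _)
      (hφB c x (x i)) _ h0
    have hd := mul_le_mul_of_nonneg_right (hDi i) hB0.le
    linarith
  have hrew : ∑ i ∈ positiveRows (fun i j => U (x i) (x j)) Q R,
      ∑ j ∈ positiveRows (fun a b => U (x b) (x a)) Q' R', U (x i) (x j) =
      ∑ i, row c x (x i) * ∑ j, h1 c i x (x j) := by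
    simp only [positiveRows, Finset.sum_filter, row, h1, col, ite_mul, one_mul, zero_mul, c]
  rw [hrew]
  calc ∑ i, row c x (x i) * ∑ j, h1 c i x (x j)
      ≤ ∑ i, (k * lam + (4 * p ^ 2 + 2) * B + k * h2 c x (x i)) := by
        refine Finset.sum_le_sum fun i _ => ?_
        have ha := mul_le_mul_of_nonneg_left (hx1 i) (hrow01 c x (x i)).1
        have hb : row c x (x i) * (k * lam + (4 * p ^ 2 + 2) * B) ≤
            1 * (k * lam + (4 * p ^ 2 + 2) * B) :=
          mul_le_mul_of_nonneg_right (hrow01 c x (x i)).2 (by positivity)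
        simp only [h2]
        linarith
    _ = k * (k * lam + (4 * p ^ 2 + 2) * B) + k * ∑ i, h2 c x (x i) := by
        rw [Finset.sum_add_distrib, Finset.mul_sum]; simp; ring
    _ ≤ k * (k * lam + (4 * p ^ 2 + 2) * B) + k * (k * lam + k * κ + 4 * p ^ 2 * B) := by gcongr
    _ = _ := by ring

/-- The kernel `∑_{t < n} c_t 1_{S_t × T_t}`. -/
def stepKernel {X : Type*} (S T : ℕ → Set X) (c : ℕ → ℝ) (n : ℕ) (u v : X) : ℝ :=
  ∑ t ∈ Finset.range n, c t * ((S t).indicator 1 u * (T t).indicator 1 v)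

lemma measurable_stepKernel {X : Type*} [MeasurableSpace X] {S T : ℕ → Set X} {c : ℕ → ℝ}
    (hS : ∀ t, MeasurableSet (S t)) (hT : ∀ t, MeasurableSet (T t)) (n : ℕ) :
    Measurable (Function.uncurry (stepKernel S T c n)) := by
  change Measurable fun z : X × X => ∑ t ∈ Finset.range n,
    c t * ((S t).indicator (1 : X → ℝ) z.1 * (T t).indicator (1 : X → ℝ) z.2)
  refine Finset.measurable_fun_sum _ fun t _ => ?_
  have h1 : Measurable fun z : X × X => (S t).indicator (1 : X → ℝ) z.1 :=
    (measurable_one.indicator (hS t)).comp measurable_fst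
  have h2 : Measurable fun z : X × X => (T t).indicator (1 : X → ℝ) z.2 :=
    (measurable_one.indicator (hT t)).comp measurable_snd
  exact (h1.mul h2).const_mul (c t)

lemma indicator_one_mem_unit {X : Type*} (S : Set X) (u : X) :
    0 ≤ S.indicator (1 : X → ℝ) u ∧ S.indicator (1 : X → ℝ) u ≤ 1 := by
  by_cases h : u ∈ S <;> simp [h]

lemma abs_stepKernel_le {X : Type*} {S T : ℕ → Set X} {c : ℕ → ℝ} {b : ℝ} (hb : ∀ t, |c t| ≤ b)
    (n : ℕ) (u v : X) : |stepKernel S T c n u v| ≤ n * b := by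
  refine (Finset.abs_sum_le_sum_abs _ _).trans ?_
  calc _ ≤ ∑ _t ∈ Finset.range n, b := Finset.sum_le_sum fun t _ => ?_
    _ = n * b := by simp
  have h1 := indicator_one_mem_unit (S t) u
  have h2 := indicator_one_mem_unit (T t) v
  rw [abs_mul, abs_of_nonneg (mul_nonneg h1.1 h2.1)]
  calc |c t| * _ ≤ b * 1 := mul_le_mul (hb t) (mul_le_one₀ h1.2 h2.1 h2.2)
        (mul_nonneg h1.1 h2.1) ((abs_nonneg _).trans (hb t))
    _ = b := mul_one b

lemma abs_setIntegral_prod_sub_le {X : Type*} [MeasurableSpace X] (μ : Measure X)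
    [IsProbabilityMeasure μ] (U : X → X → ℝ) (hU : Measurable (Function.uncurry U)) {B : ℝ}
    (hB : ∀ ξ ζ, |U ξ ζ| ≤ B) {S S' T T' : Set X} (hS : MeasurableSet S) (hS' : MeasurableSet S')
    (hT : MeasurableSet T) (hT' : MeasurableSet T') :
    |∫ z in S ×ˢ T, U z.1 z.2 ∂(μ.prod μ) - ∫ z in S' ×ˢ T', U z.1 z.2 ∂(μ.prod μ)| ≤
      B * (μ.real (symmDiff S S') + μ.real (symmDiff T T')) := by
  have hUi : Integrable (fun z : X × X => U z.1 z.2) (μ.prod μ) :=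
    Integrable.of_bound hU.aestronglyMeasurable B (ae_of_all _ fun z => hB z.1 z.2)
  have hdS : MeasurableSet (symmDiff S S') := hS.symmDiff hS'
  have hdT : MeasurableSet (symmDiff T T') := hT.symmDiff hT'
  rw [← integral_indicator (hS.prod hT), ← integral_indicator (hS'.prod hT'),
    ← integral_sub (hUi.indicator (hS.prod hT)) (hUi.indicator (hS'.prod hT'))]
  have hfst : ∫ z : X × X, (Prod.fst ⁻¹' symmDiff S S').indicator (1 : X × X → ℝ) z ∂(μ.prod μ)
      = μ.real (symmDiff S S') := by
    rw [integral_indicator_one (measurable_fst hdS), Measure.real, Measure.real]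
    rw [measurePreserving_fst.measure_preimage hdS.nullMeasurableSet]
  have hsnd : ∫ z : X × X, (Prod.snd ⁻¹' symmDiff T T').indicator (1 : X × X → ℝ) z ∂(μ.prod μ)
      = μ.real (symmDiff T T') := by
    rw [integral_indicator_one (measurable_snd hdT), Measure.real, Measure.real]
    rw [measurePreserving_snd.measure_preimage hdT.nullMeasurableSet]
  have hi1 : Integrable ((Prod.fst ⁻¹' symmDiff S S').indicator (1 : X × X → ℝ)) (μ.prod μ) :=
    (integrable_const (1 : ℝ)).indicator (measurable_fst hdS)
  have hi2 : Integrable ((Prod.snd ⁻¹' symmDiff T T').indicator (1 : X × X → ℝ)) (μ.prod μ) :=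
    (integrable_const (1 : ℝ)).indicator (measurable_snd hdT)
  rw [← hfst, ← hsnd, ← integral_add hi1 hi2, ← integral_const_mul]
  refine (abs_integral_le_integral_abs).trans (integral_mono ?_ ((hi1.add hi2).const_mul B) ?_)
  · exact ((hUi.indicator (hS.prod hT)).sub (hUi.indicator (hS'.prod hT'))).abs
  · rintro ⟨ξ, ζ⟩
    have h := hB ξ ζ
    have h0 := (abs_nonneg _).trans h
    by_cases h1 : ξ ∈ S <;> by_cases h2 : ξ ∈ S' <;> by_cases h3 : ζ ∈ T <;>
      by_cases h4 : ζ ∈ T' <;>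
      simp [Set.mem_symmDiff, h1, h2, h3, h4] <;> linarith

/-- Cut decomposition: a bounded kernel is approximated in cut norm by a combination of few
rectangles with sides in a prescribed dense family. -/
lemma exists_stepKernel_approx {X : Type*} [MeasurableSpace X] (μ : Measure X)
    [IsProbabilityMeasure μ] {𝒜 : Set (Set X)} (h𝒜 : μ.MeasureDense 𝒜) (W : X → X → ℝ)
    (hW : Measurable (Function.uncurry W)) (hW1 : ∀ ξ ζ, |W ξ ζ| ≤ 1) {m : ℕ} (hm : 0 < m) :
    ∃ (S T : ℕ → Set X) (c : ℕ → ℝ), (∀ t, S t ∈ 𝒜) ∧ (∀ t, T t ∈ 𝒜) ∧ (∀ t, |c t| ≤ 1 / m) ∧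
      ∀ A B : Set X, MeasurableSet A → MeasurableSet B →
        |∫ z in A ×ˢ B, (W z.1 z.2 - stepKernel S T c (m ^ 2 + 1) z.1 z.2) ∂(μ.prod μ)| ≤
          1 / m := by
  have hm' : (0 : ℝ) < m := by exact_mod_cast hm
  have hstep : ∀ n : ℕ, ∃ (S T : ℕ → Set X) (c : ℕ → ℝ), (∀ t, S t ∈ 𝒜) ∧ (∀ t, T t ∈ 𝒜) ∧
      (∀ t, |c t| ≤ 1 / m) ∧
      ((∀ A B : Set X, MeasurableSet A → MeasurableSet B →
        |∫ z in A ×ˢ B, (W z.1 z.2 - stepKernel S T c n z.1 z.2) ∂(μ.prod μ)| ≤ 1 / m) ∨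
      ∫ z, (W z.1 z.2 - stepKernel S T c n z.1 z.2) ^ 2 ∂(μ.prod μ) ≤ 1 - n / m ^ 2) := by
    intro n
    induction n with
    | zero =>
      obtain ⟨A, hA⟩ := h𝒜.nonempty
      refine ⟨fun _ => A, fun _ => A, fun _ => 0, fun _ => hA, fun _ => hA, by simp, Or.inr ?_⟩
      have := abs_integral_le_of_abs_le (μ.prod μ) (B := 1)
        (f := fun z => (W z.1 z.2 - stepKernel (fun _ => A) (fun _ => A) (fun _ => 0) 0 z.1 z.2) ^ 2)
        (by
          intro z
          simpa [stepKernel] using hW1 z.1 z.2)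
      simpa using (le_abs_self _).trans this
    | succ n ih =>
      obtain ⟨S, T, c, hS, hT, hc, h⟩ := ih
      have hext : ∀ (A' B' : Set X) (c' : ℝ) (u v : X),
          stepKernel (Function.update S n A') (Function.update T n B') (Function.update c n c')
            (n + 1) u v = stepKernel S T c n u v
              + c' * (A'.indicator 1 u * B'.indicator 1 v) := by
        intro A' B' c' u v
        simp only [stepKernel, Finset.sum_range_succ, Function.update_self]
        congr 1
        refine Finset.sum_congr rfl fun t ht => ?_
        have : t ≠ n := (Finset.mem_range.1 ht).ne
        simp [this]
      by_cases hgood : ∀ A B : Set X, MeasurableSet A → MeasurableSet B →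
        |∫ z in A ×ˢ B, (W z.1 z.2 - stepKernel S T c n z.1 z.2) ∂(μ.prod μ)| ≤ 1 / m
      · refine ⟨Function.update S n (S n), Function.update T n (T n), Function.update c n 0,
          by simpa using hS, by simpa using hT,
          (Function.forall_update_iff c fun _ y => |y| ≤ 1 / (m : ℝ)).2 ⟨by simp, fun t _ => hc t⟩, Or.inl ?_⟩
        simpa only [hext, zero_mul, add_zero] using hgood
      have hE := h.resolve_left hgood
      push Not at hgood
      obtain ⟨A, B, hA, hB, hAB⟩ := hgood
      set U : X → X → ℝ := fun u v => W u v - stepKernel S T c n u v with hUdef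
      have hUm : Measurable (Function.uncurry U) :=
        hW.sub (measurable_stepKernel (fun t => h𝒜.measurable _ (hS t))
          (fun t => h𝒜.measurable _ (hT t)) n)
      set b : ℝ := 1 + n * (1 / m) with hbdef
      have hb0 : 0 < b := by positivity
      have hUb : ∀ u v, |U u v| ≤ b := fun u v =>
        (abs_sub _ _).trans (add_le_add (hW1 u v) (abs_stepKernel_le hc n u v))
      set gap := |∫ z in A ×ˢ B, U z.1 z.2 ∂(μ.prod μ)| - 1 / m with hgap
      have hgap0 : 0 < gap := by simpa [hgap] using hAB
      obtain ⟨A', hA', hAA'⟩ := h𝒜.approx A hA (measure_ne_top _ _) (gap / (4 * b)) (by positivity)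
      obtain ⟨B', hB', hBB'⟩ := h𝒜.approx B hB (measure_ne_top _ _) (gap / (4 * b)) (by positivity)
      have hA'm := h𝒜.measurable _ hA'
      have hB'm := h𝒜.measurable _ hB'
      have hreal : ∀ {s : Set X} {e : ℝ}, 0 < e → μ s < ENNReal.ofReal e → μ.real s ≤ e :=
        fun he h => ENNReal.toReal_le_of_le_ofReal he.le h.le
      have hd := abs_setIntegral_prod_sub_le μ U hUm hUb hA hA'm hB hB'm
      have hd2 : b * (μ.real (symmDiff A A') + μ.real (symmDiff B B')) ≤ gap / 2 := by
        calc _ ≤ b * (gap / (4 * b) + gap / (4 * b)) := by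
              gcongr
              · exact hreal (by positivity) hAA'
              · exact hreal (by positivity) hBB'
          _ = gap / 2 := by field_simp; ring
      set I := ∫ z in A' ×ˢ B', U z.1 z.2 ∂(μ.prod μ) with hI
      have hIbig : 1 / m < |I| := by
        have := abs_sub_abs_le_abs_sub (∫ z in A ×ˢ B, U z.1 z.2 ∂(μ.prod μ)) I
        linarith
      obtain ⟨c', hc', hc'I⟩ : ∃ c' : ℝ, |c'| = 1 / m ∧ c' * I = 1 / m * |I| := by
        rcases le_total 0 I with h0 | h0
        · exact ⟨1 / m, abs_of_pos (by positivity), by rw [abs_of_nonneg h0]⟩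
        · exact ⟨-(1 / m), by rw [abs_neg, abs_of_pos (by positivity)], by
            rw [abs_of_nonpos h0]; ring⟩
      refine ⟨Function.update S n A', Function.update T n B', Function.update c n c',
        (Function.forall_update_iff S fun _ s => s ∈ 𝒜).2 ⟨hA', fun t _ => hS t⟩,
        (Function.forall_update_iff T fun _ s => s ∈ 𝒜).2 ⟨hB', fun t _ => hT t⟩,
        (Function.forall_update_iff c fun _ y => |y| ≤ 1 / (m : ℝ)).2 ⟨hc'.le, fun t _ => hc t⟩, Or.inr ?_⟩
      simp only [hext]
      have hUi : Integrable (fun z : X × X => U z.1 z.2) (μ.prod μ) :=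
        Integrable.of_bound hUm.aestronglyMeasurable b (ae_of_all _ fun z => hUb z.1 z.2)
      have hU2i : Integrable (fun z : X × X => U z.1 z.2 ^ 2) (μ.prod μ) := by
        refine Integrable.of_bound (hUm.pow_const 2).aestronglyMeasurable (b ^ 2)
          (ae_of_all _ fun z => ?_)
        rw [Real.norm_eq_abs, abs_pow]
        exact pow_le_pow_left₀ (abs_nonneg _) (hUb z.1 z.2) 2
      have hR : MeasurableSet (A' ×ˢ B') := hA'm.prod hB'm
      have hpt : ∀ z : X × X, (W z.1 z.2 - (stepKernel S T c n z.1 z.2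
          + c' * (A'.indicator 1 z.1 * B'.indicator 1 z.2))) ^ 2 =
          U z.1 z.2 ^ 2 - 2 * c' * (A' ×ˢ B').indicator (fun z => U z.1 z.2) z
            + c' ^ 2 * (A' ×ˢ B').indicator (1 : X × X → ℝ) z := by
        rintro ⟨u, v⟩
        by_cases h1 : u ∈ A' <;> by_cases h2 : v ∈ B' <;> simp [h1, h2, hUdef]
        ring
      simp only [hpt]
      have hi1 : Integrable (fun z : X × X => 2 * c' * (A' ×ˢ B').indicator (fun z => U z.1 z.2) z)
          (μ.prod μ) := (hUi.indicator hR).const_mul _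
      have hi2 : Integrable (fun z : X × X => c' ^ 2 * (A' ×ˢ B').indicator (1 : X × X → ℝ) z)
          (μ.prod μ) := ((integrable_const (1 : ℝ)).indicator hR).const_mul _
      have hi3 : Integrable (fun z : X × X => U z.1 z.2 ^ 2
          - 2 * c' * (A' ×ˢ B').indicator (fun z => U z.1 z.2) z) (μ.prod μ) := hU2i.sub hi1
      rw [integral_add hi3 hi2, integral_sub hU2i hi1, integral_const_mul,
        integral_const_mul, integral_indicator hR, integral_indicator_one hR]
      have hp1 : (μ.prod μ).real (A' ×ˢ B') ≤ 1 := measureReal_le_one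
      have hc2 : c' ^ 2 = 1 / m ^ 2 := by rw [← sq_abs, hc']; ring
      have hcI2 : 1 / (m : ℝ) ^ 2 ≤ c' * I := by
        rw [hc'I]
        calc 1 / (m : ℝ) ^ 2 = 1 / m * (1 / m) := by ring
          _ ≤ 1 / m * |I| := by gcongr
      rw [← hI]
      have h3 : c' ^ 2 * (μ.prod μ).real (A' ×ˢ B') ≤ 1 / m ^ 2 := by
        rw [hc2]; exact mul_le_of_le_one_right (by positivity) hp1
      have h4 : (1 : ℝ) - ((n + 1 : ℕ) : ℝ) / m ^ 2 = 1 - n / m ^ 2 - 1 / m ^ 2 := by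
        push_cast; ring
      rw [h4]
      linarith
  obtain ⟨S, T, c, hS, hT, hc, h⟩ := hstep (m ^ 2 + 1)
  refine ⟨S, T, c, hS, hT, hc, h.resolve_right fun h => ?_⟩
  have h0 : 0 ≤ ∫ z, (W z.1 z.2 - stepKernel S T c (m ^ 2 + 1) z.1 z.2) ^ 2 ∂(μ.prod μ) :=
    integral_nonneg fun z => sq_nonneg _
  have : (1 : ℝ) < ((m ^ 2 + 1 : ℕ) : ℝ) / m ^ 2 := by
    rw [lt_div_iff₀ (by positivity)]; push_cast; linarith
  linarith

lemma Qn_le_iff {n : ℕ} {x : ℝ} {j : ℕ} : Qn n x ≤ j ↔ 1 ≤ j ∧ (n : ℝ) * x ≤ j := by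
  simp [Qn, Nat.ceil_le]

lemma one_le_Qn (n : ℕ) (x : ℝ) : 1 ≤ Qn n x := le_max_left _ _

lemma Qn_mono (n : ℕ) : Monotone (Qn n) := fun x y h => by
  have h2 := Qn_le_iff.1 (le_refl (Qn n y))
  exact Qn_le_iff.2 ⟨h2.1, (mul_le_mul_of_nonneg_left h (Nat.cast_nonneg n)).trans h2.2⟩

lemma Qn_le_self {n : ℕ} (hn : 0 < n) (x : UI) : Qn n x ≤ n :=
  Qn_le_iff.2 ⟨hn, mul_le_of_le_one_right (Nat.cast_nonneg n) x.2.2⟩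

lemma Qn_le_iff_mul {d e : ℕ} (he : 0 < e) {x : ℝ} {j : ℕ} :
    Qn d x ≤ j ↔ Qn (d * e) x ≤ j * e := by
  rw [Qn_le_iff, Qn_le_iff]
  have he' : (0 : ℝ) < e := by exact_mod_cast he
  refine and_congr ⟨fun h => Nat.mul_pos h he, fun h => Nat.pos_of_mul_pos_right h⟩ ?_
  push_cast
  rw [mul_right_comm, mul_le_mul_iff_left₀ he']

lemma Qn_eq_of_mul {d e : ℕ} (he : 0 < e) {x y : ℝ} (h : Qn (d * e) x = Qn (d * e) y) :
    Qn d x = Qn d y :=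
  le_antisymm ((Qn_le_iff_mul he).2 (h ▸ (Qn_le_iff_mul he).1 le_rfl))
    ((Qn_le_iff_mul he).2 (h ▸ (Qn_le_iff_mul he).1 le_rfl))

lemma Qn_eq_of_dvd {d n : ℕ} (hn : 0 < n) (hd : d ∣ n) {x y : ℝ} (h : Qn n x = Qn n y) :
    Qn d x = Qn d y := by
  obtain ⟨e, rfl⟩ := hd
  exact Qn_eq_of_mul (Nat.pos_of_mul_pos_left hn) h

lemma measurable_Qn (n : ℕ) : Measurable fun x : UI => Qn n (x : ℝ) :=
  ((Qn_mono n).measurable).comp measurable_subtype_coe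

/-- A subset of the square that is a union of cells of the `n × n` grid. -/
def GridSet (n : ℕ) (S : Set USq) : Prop :=
  ∀ u v : USq, Qn n (u.1 : ℝ) = Qn n (v.1 : ℝ) → Qn n (u.2 : ℝ) = Qn n (v.2 : ℝ) →
    (u ∈ S ↔ v ∈ S)

lemma GridSet.of_dvd {d n : ℕ} (hn : 0 < n) (hd : d ∣ n) {S : Set USq} (h : GridSet d S) :
    GridSet n S :=
  fun u v h1 h2 => h u v (Qn_eq_of_dvd hn hd h1) (Qn_eq_of_dvd hn hd h2)

/-- The family of measurable sets that are unions of cells of some grid. -/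
def gridAlgebra : Set (Set USq) := {S | MeasurableSet S ∧ ∃ n, 0 < n ∧ GridSet n S}

lemma isSetAlgebra_gridAlgebra : IsSetAlgebra gridAlgebra where
  empty_mem := ⟨MeasurableSet.empty, 1, one_pos, fun _ _ _ _ => Iff.rfl⟩
  compl_mem := fun _ ⟨hm, n, hn, h⟩ =>
    ⟨hm.compl, n, hn, fun u v h1 h2 => not_congr (h u v h1 h2)⟩
  union_mem := fun _ _ ⟨hm, n, hn, h⟩ ⟨hm', n', hn', h'⟩ =>
    ⟨hm.union hm', n * n', Nat.mul_pos hn hn', fun u v h1 h2 => or_congr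
      (h.of_dvd (Nat.mul_pos hn hn') (dvd_mul_right _ _) u v h1 h2)
      (h'.of_dvd (Nat.mul_pos hn hn') (dvd_mul_left _ _) u v h1 h2)⟩

lemma Iic_eq_iInter_Qn (a : UI) :
    Set.Iic a = ⋂ n : ℕ, {x : UI | Qn (n + 1) (x : ℝ) ≤ Qn (n + 1) (a : ℝ)} := by
  ext x
  simp only [Set.mem_Iic, Set.mem_iInter]
  refine ⟨fun h n => Qn_mono _ h, fun h => ?_⟩
  by_contra! hlt
  have hpos : (0 : ℝ) < x - a := sub_pos.2 hlt
  obtain ⟨n, hn⟩ := exists_nat_gt (1 / ((x : ℝ) - a))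
  have h1 : (((n + 1 : ℕ) : ℝ)) * x ≤ (Qn (n + 1) (a : ℝ) : ℝ) := (Qn_le_iff.1 (h n)).2
  have ha : (0 : ℝ) ≤ a := a.2.1
  have h2 : (Qn (n + 1) (a : ℝ) : ℝ) ≤ ((n + 1 : ℕ) : ℝ) * a + 1 := by
    have h3 := (Nat.ceil_lt_add_one (mul_nonneg (Nat.cast_nonneg (n + 1)) ha)).le
    have h4 : (0 : ℝ) ≤ ((n + 1 : ℕ) : ℝ) * a := mul_nonneg (Nat.cast_nonneg _) ha
    rw [Qn, Nat.cast_max]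
    exact max_le (by push_cast at h4 ⊢; linarith) h3
  rw [div_lt_iff₀ hpos] at hn
  push_cast at h1 h2
  nlinarith

lemma generateFrom_gridAlgebra :
    MeasurableSpace.generateFrom gridAlgebra = (inferInstance : MeasurableSpace USq) := by
  refine le_antisymm (MeasurableSpace.generateFrom_le fun S hS => hS.1) ?_
  have key : ∀ g : USq → UI, Measurable g →
      (∀ n u v, Qn n (u.1 : ℝ) = Qn n (v.1 : ℝ) → Qn n (u.2 : ℝ) = Qn n (v.2 : ℝ) →
        Qn n (g u : ℝ) = Qn n (g v : ℝ)) →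
      @Measurable _ _ (MeasurableSpace.generateFrom gridAlgebra) _ g := by
    intro g hg hgrid
    let := MeasurableSpace.generateFrom gridAlgebra
    refine measurable_of_Iic fun a => ?_
    rw [Iic_eq_iInter_Qn, Set.preimage_iInter]
    refine MeasurableSet.iInter fun n => MeasurableSpace.measurableSet_generateFrom ⟨?_, n + 1,
      Nat.succ_pos n, fun u v h1 h2 => ?_⟩
    · exact hg (measurable_Qn (n + 1) measurableSet_Iic)
    · simp only [Set.mem_preimage, Set.mem_ofPred_eq, hgrid (n + 1) u v h1 h2]
  refine sup_le ?_ ?_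
  · exact (key Prod.fst measurable_fst fun n u v h _ => h).comap_le
  · exact (key Prod.snd measurable_snd fun n u v _ h => h).comap_le

lemma measureDense_gridAlgebra : (volume : Measure USq).MeasureDense gridAlgebra :=
  Measure.MeasureDense.of_generateFrom_isSetAlgebra_finite _ isSetAlgebra_gridAlgebra
    generateFrom_gridAlgebra.symm

lemma exists_common_grid {S : ℕ → Set USq} (hS : ∀ t, S t ∈ gridAlgebra) (n : ℕ) :
    ∃ d, 0 < d ∧ ∀ t < n, GridSet d (S t) := by
  choose _ N hN hgrid using hS
  have hpos : 0 < ∏ t ∈ Finset.range n, N t := Finset.prod_pos fun t _ => hN t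
  exact ⟨_, hpos, fun t ht =>
    (hgrid t).of_dvd hpos (Finset.dvd_prod_of_mem N (Finset.mem_range.2 ht))⟩

/-- The index of the cell of the uniform partition of `[0,1]` into `n` intervals containing `x`. -/
def cellIdx (n : ℕ) [NeZero n] (x : UI) : Fin n :=
  ⟨Qn n (x : ℝ) - 1, by
    have := Qn_le_self (NeZero.pos n) x
    have := one_le_Qn n (x : ℝ)
    omega⟩

lemma cellIdx_val (n : ℕ) [NeZero n] (x : UI) : (cellIdx n x : ℕ) + 1 = Qn n (x : ℝ) :=
  Nat.sub_add_cancel (one_le_Qn n (x : ℝ))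

lemma cellIdx_eq_iff {n : ℕ} [NeZero n] {x y : UI} :
    cellIdx n x = cellIdx n y ↔ Qn n (x : ℝ) = Qn n (y : ℝ) := by
  rw [← cellIdx_val, ← cellIdx_val, Fin.ext_iff, add_left_inj]

lemma measurable_cellIdx (n : ℕ) [NeZero n] : Measurable (cellIdx n) := by
  refine measurable_to_countable' fun i => ?_
  have : cellIdx n ⁻¹' {i} = (fun x : UI => Qn n (x : ℝ)) ⁻¹' {(i : ℕ) + 1} := by
    ext x
    simp [← cellIdx_val, Fin.ext_iff]
  rw [this]
  exact measurable_Qn n (measurableSet_singleton _)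

/-- The `i`-th cell `(i/n, (i+1)/n]` of the uniform partition. -/
def posCell (n : ℕ) (i : Fin n) : Set UI :=
  {x | (i : ℝ) / n < x ∧ (x : ℝ) ≤ ((i : ℝ) + 1) / n}

lemma mem_posCell_iff {n : ℕ} [NeZero n] {i : Fin n} {x : UI} :
    x ∈ posCell n i ↔ 0 < (x : ℝ) ∧ cellIdx n x = i := by
  have hn : (0 : ℝ) < n := by exact_mod_cast NeZero.pos n
  rw [posCell, Set.mem_ofPred_eq, div_lt_iff₀ hn, le_div_iff₀ hn, mul_comm]
  have h1 : Qn n (x : ℝ) ≤ (i : ℕ) + 1 ↔ (n : ℝ) * x ≤ (i : ℝ) + 1 := by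
    simp [Qn_le_iff]
  have h2 : Qn n (x : ℝ) ≤ (i : ℕ) ↔ 1 ≤ (i : ℕ) ∧ (n : ℝ) * x ≤ (i : ℝ) := Qn_le_iff
  rw [← cellIdx_val] at h1 h2
  rw [← h1, Fin.ext_iff]
  constructor
  · rintro ⟨h3, h4⟩
    have hx : (0 : ℝ) < x := by
      have : (0 : ℝ) < n * x := lt_of_le_of_lt (Nat.cast_nonneg _) h3
      exact pos_of_mul_pos_right this hn.le
    refine ⟨hx, ?_⟩
    by_contra h5
    have := h2.1 (by omega)
    linarith [this.2]
  · rintro ⟨h3, h4⟩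
    refine ⟨?_, by omega⟩
    by_contra! h5
    rcases Nat.eq_zero_or_pos (i : ℕ) with h0 | h0
    · rw [h0, Nat.cast_zero] at h5
      have := mul_pos hn h3
      linarith
    · have := h2.2 ⟨h0, h5⟩
      omega

lemma measurableSet_posCell (n : ℕ) (i : Fin n) : MeasurableSet (posCell n i) :=
  (measurableSet_lt measurable_const measurable_subtype_coe).inter
    (measurableSet_le measurable_subtype_coe measurable_const)

lemma volume_UI_apply (E : Set UI) : volume E = volume (Subtype.val '' E : Set ℝ) :=
  comap_subtype_coe_apply measurableSet_Icc volume E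

lemma image_posCell {n : ℕ} (i : Fin n) :
    (Subtype.val '' posCell n i : Set ℝ) = Set.Ioc ((i : ℝ) / n) (((i : ℝ) + 1) / n) := by
  have hn : (0 : ℝ) < n := by exact_mod_cast i.pos
  have hi : ((i : ℝ) + 1) ≤ n := by exact_mod_cast i.2
  ext x
  constructor
  · rintro ⟨y, hy, rfl⟩
    exact hy
  · intro hx
    have h0 : 0 ≤ x := le_trans (by positivity) hx.1.le
    have h1 : x ≤ 1 := hx.2.trans ((div_le_one hn).2 hi)
    exact ⟨⟨x, h0, h1⟩, hx, rfl⟩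

lemma volume_posCell {n : ℕ} (i : Fin n) : volume (posCell n i) = ENNReal.ofReal (1 / n) := by
  rw [volume_UI_apply, image_posCell, Real.volume_Ioc]
  congr 1
  ring

/-- The translation of `[0,1]` that takes cell `i` to cell `j`. -/
def cellShift (n : ℕ) (i j : Fin n) (x : UI) : UI :=
  Set.projIcc 0 1 zero_le_one ((x : ℝ) + ((j : ℝ) - i) / n)

lemma cellShift_val {n : ℕ} {i j : Fin n} {x : UI} (hx : x ∈ posCell n i) :
    (cellShift n i j x : ℝ) = x + ((j : ℝ) - i) / n := by
  have hn : (0 : ℝ) < n := by exact_mod_cast i.pos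
  have hj : ((j : ℝ) + 1) ≤ n := by exact_mod_cast j.2
  have hx1 := hx.1
  have hx2 := hx.2
  have h1 : (0 : ℝ) ≤ j / n := by positivity
  have h2 : ((j : ℝ) + 1) / n ≤ 1 := (div_le_one hn).2 hj
  have h3 : ((j : ℝ) - i) / n = j / n - i / n := by ring
  have h4 : ((j : ℝ) + 1) / n = j / n + 1 / n := by ring
  have h5 : ((i : ℝ) + 1) / n = i / n + 1 / n := by ring
  rw [cellShift, Set.projIcc_of_mem zero_le_one
    (show (x : ℝ) + ((j : ℝ) - i) / n ∈ Set.Icc (0 : ℝ) 1 from ⟨by linarith, by linarith⟩)]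

lemma cellShift_mem {n : ℕ} {i j : Fin n} {x : UI} (hx : x ∈ posCell n i) :
    cellShift n i j x ∈ posCell n j := by
  have hx1 := hx.1
  have hx2 := hx.2
  have h3 : ((j : ℝ) - i) / n = j / n - i / n := by ring
  have h4 : ((j : ℝ) + 1) / n = j / n + 1 / n := by ring
  have h5 : ((i : ℝ) + 1) / n = i / n + 1 / n := by ring
  rw [posCell, Set.mem_ofPred_eq, cellShift_val hx]
  exact ⟨by linarith, by linarith⟩

lemma cellShift_cellShift {n : ℕ} {i j : Fin n} {x : UI} (hx : x ∈ posCell n i) :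
    cellShift n j i (cellShift n i j x) = x := by
  refine Subtype.ext ?_
  rw [cellShift_val (cellShift_mem hx), cellShift_val hx]
  ring

lemma measurable_cellShift (n : ℕ) (i j : Fin n) : Measurable (cellShift n i j) :=
  continuous_projIcc.measurable.comp (measurable_subtype_coe.add_const _)

lemma measurePreserving_cellShift (n : ℕ) (i j : Fin n) :
    MeasurePreserving (cellShift n i j) (volume.restrict (posCell n i))
      (volume.restrict (posCell n j)) := by
  refine ⟨measurable_cellShift n i j, ?_⟩
  ext E hE
  have hE' := measurable_cellShift n i j hE
  rw [Measure.map_apply (measurable_cellShift n i j) hE, Measure.restrict_apply hE',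
    Measure.restrict_apply hE, volume_UI_apply, volume_UI_apply]
  rw [← measure_preimage_add_right volume (((j : ℝ) - i) / n)
    (Subtype.val '' (E ∩ posCell n j))]
  congr 1
  ext x
  constructor
  · rintro ⟨y, ⟨hy, hy'⟩, rfl⟩
    exact ⟨_, ⟨hy, cellShift_mem hy'⟩, cellShift_val hy'⟩
  · rintro ⟨y, ⟨hy, hy'⟩, hxy⟩
    have hx : ((cellShift n j i y : UI) : ℝ) = x := by
      rw [cellShift_val hy', hxy]; ring
    refine ⟨cellShift n j i y, ⟨?_, cellShift_mem hy'⟩, hx⟩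
    rw [Set.mem_preimage, cellShift_cellShift hy']
    exact hy

/-- The cell of the `n × n` grid containing a point of the square. -/
def gridCell (n : ℕ) [NeZero n] (u : USq) : Fin n × Fin n := (cellIdx n u.1, cellIdx n u.2)

lemma measurable_gridCell (n : ℕ) [NeZero n] : Measurable (gridCell n) :=
  ((measurable_cellIdx n).comp measurable_fst).prodMk ((measurable_cellIdx n).comp measurable_snd)

/-- The part of the square where both coordinates are positive. -/
def posSquare : Set USq := {u | 0 < (u.1 : ℝ) ∧ 0 < (u.2 : ℝ)}

lemma measurableSet_posSquare : MeasurableSet posSquare :=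
  (measurableSet_lt measurable_const (measurable_subtype_coe.comp measurable_fst)).inter
    (measurableSet_lt measurable_const (measurable_subtype_coe.comp measurable_snd))

lemma mem_posCell_prod_iff {n : ℕ} [NeZero n] {c : Fin n × Fin n} {u : USq} :
    u ∈ posCell n c.1 ×ˢ posCell n c.2 ↔ u ∈ posSquare ∧ gridCell n u = c := by
  rw [Set.mem_prod, mem_posCell_iff, mem_posCell_iff, gridCell, Prod.ext_iff, posSquare,
    Set.mem_ofPred_eq]
  tauto

lemma posSquare_eq_iUnion (n : ℕ) [NeZero n] :
    posSquare = ⋃ c : Fin n × Fin n, posCell n c.1 ×ˢ posCell n c.2 := by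
  ext u
  simp only [Set.mem_iUnion, mem_posCell_prod_iff, exists_and_left, exists_eq', and_true]

lemma volume_compl_posSquare : volume posSquareᶜ = 0 := by
  have h0 : (volume : Measure UI) {0} = 0 := by
    rw [volume_UI_apply, Set.image_singleton, Real.volume_singleton]
  have : posSquareᶜ ⊆ ({0} : Set UI) ×ˢ Set.univ ∪ Set.univ ×ˢ ({0} : Set UI) := by
    intro u hu
    by_contra h
    refine hu ?_
    simp only [Set.mem_union, Set.mem_prod, Set.mem_singleton_iff, Set.mem_univ, and_true,
      true_and, not_or] at h
    exact ⟨lt_of_le_of_ne u.1.2.1 fun h' => h.1 (Subtype.ext h'.symm),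
      lt_of_le_of_ne u.2.2.1 fun h' => h.2 (Subtype.ext h'.symm)⟩
  refine measure_mono_null this (measure_union_null ?_ ?_)
  · rw [Measure.volume_eq_prod, Measure.prod_prod, h0, zero_mul]
  · rw [Measure.volume_eq_prod, Measure.prod_prod, h0, mul_zero]

lemma volume_eq_sum_cells (n : ℕ) [NeZero n] :
    (volume : Measure USq) = Measure.sum fun c : Fin n × Fin n =>
      volume.restrict (posCell n c.1 ×ˢ posCell n c.2) := by
  rw [← Measure.restrict_iUnion, ← posSquare_eq_iUnion, Measure.restrict_eq_self_of_ae_mem]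
  · exact mem_ae_iff.2 volume_compl_posSquare
  · intro c d hcd
    refine Set.disjoint_left.2 fun u hu hu' => hcd ?_
    rw [mem_posCell_prod_iff] at hu hu'
    exact hu.2.symm.trans hu'.2
  · exact fun c => (measurableSet_posCell n _).prod (measurableSet_posCell n _)

lemma volume_cell {n : ℕ} (c : Fin n × Fin n) :
    volume (posCell n c.1 ×ˢ posCell n c.2) = ENNReal.ofReal (1 / (n : ℝ) ^ 2) := by
  rw [Measure.volume_eq_prod, Measure.prod_prod, volume_posCell, volume_posCell,
    ← ENNReal.ofReal_mul (by positivity)]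
  congr 1
  ring

/-- The bijection of the square that permutes the cells of the `n × n` grid by translations. -/
def cellPerm (n : ℕ) [NeZero n] (τ : Equiv.Perm (Fin n × Fin n)) (u : USq) : USq :=
  if u ∈ posSquare then
    (cellShift n (gridCell n u).1 (τ (gridCell n u)).1 u.1,
      cellShift n (gridCell n u).2 (τ (gridCell n u)).2 u.2)
  else u

lemma cellPerm_mem {n : ℕ} [NeZero n] (τ : Equiv.Perm (Fin n × Fin n)) {c : Fin n × Fin n}
    {u : USq} (hu : u ∈ posCell n c.1 ×ˢ posCell n c.2) :
    cellPerm n τ u ∈ posCell n (τ c).1 ×ˢ posCell n (τ c).2 := by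
  have h := mem_posCell_prod_iff.1 hu
  rw [cellPerm, if_pos h.1, h.2]
  exact ⟨cellShift_mem hu.1, cellShift_mem hu.2⟩

lemma gridCell_cellPerm {n : ℕ} [NeZero n] (τ : Equiv.Perm (Fin n × Fin n)) {u : USq}
    (hu : u ∈ posSquare) : gridCell n (cellPerm n τ u) = τ (gridCell n u) :=
  (mem_posCell_prod_iff.1 (cellPerm_mem τ (mem_posCell_prod_iff.2 ⟨hu, (rfl : gridCell n u = gridCell n u)⟩))).2

lemma cellPerm_symm_cellPerm {n : ℕ} [NeZero n] (τ : Equiv.Perm (Fin n × Fin n)) (u : USq) :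
    cellPerm n τ.symm (cellPerm n τ u) = u := by
  by_cases hu : u ∈ posSquare
  · have hc := mem_posCell_prod_iff.2 ⟨hu, (rfl : gridCell n u = gridCell n u)⟩
    have h := mem_posCell_prod_iff.1 (cellPerm_mem τ hc)
    rw [cellPerm, if_pos h.1, h.2, cellPerm, if_pos hu]
    simp only [Equiv.symm_apply_apply]
    exact Prod.ext (cellShift_cellShift hc.1) (cellShift_cellShift hc.2)
  · rw [cellPerm, cellPerm, if_neg hu, if_neg hu]

lemma measurable_cellPerm (n : ℕ) [NeZero n] (τ : Equiv.Perm (Fin n × Fin n)) :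
    Measurable (cellPerm n τ) := by
  refine Measurable.ite measurableSet_posSquare ?_ measurable_id
  let F : Fin n × Fin n → USq → USq := fun c =>
    Prod.map (cellShift n c.1 (τ c).1) (cellShift n c.2 (τ c).2)
  have hF : ∀ c, Measurable (F c) := fun c =>
    (measurable_cellShift n c.1 (τ c).1).prodMap (measurable_cellShift n c.2 (τ c).2)
  have h : Measurable (Function.uncurry F) := measurable_from_prod_countable_right hF
  exact h.comp ((measurable_gridCell n).prodMk measurable_id)

lemma measurePreserving_cellPerm (n : ℕ) [NeZero n] (τ : Equiv.Perm (Fin n × Fin n)) :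
    MeasurePreserving (cellPerm n τ) volume volume := by
  refine ⟨measurable_cellPerm n τ, ?_⟩
  have hpiece : ∀ c : Fin n × Fin n,
      (volume.restrict (posCell n c.1 ×ˢ posCell n c.2)).map (cellPerm n τ) =
        volume.restrict (posCell n (τ c).1 ×ˢ posCell n (τ c).2) := by
    intro c
    have h1 : (volume.restrict (posCell n c.1 ×ˢ posCell n c.2)).map (cellPerm n τ) =
        (volume.restrict (posCell n c.1 ×ˢ posCell n c.2)).map
          (Prod.map (cellShift n c.1 (τ c).1) (cellShift n c.2 (τ c).2)) := by
      refine Measure.map_congr ?_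
      filter_upwards [ae_restrict_mem
        ((measurableSet_posCell n c.1).prod (measurableSet_posCell n c.2))] with u hu
      have h := mem_posCell_prod_iff.1 hu
      rw [cellPerm, if_pos h.1, h.2, Prod.map]
    rw [h1, Measure.volume_eq_prod, ← Measure.prod_restrict, ← Measure.prod_restrict]
    exact ((measurePreserving_cellShift n c.1 (τ c).1).prod
      (measurePreserving_cellShift n c.2 (τ c).2)).map_eq
  conv_lhs => rw [volume_eq_sum_cells n]
  rw [Measure.map_sum (measurable_cellPerm n τ).aemeasurable]
  simp only [hpiece]
  conv_rhs => rw [volume_eq_sum_cells n]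
  ext E hE
  rw [Measure.sum_apply _ hE, Measure.sum_apply _ hE]
  exact τ.tsum_eq fun c => volume.restrict (posCell n c.1 ×ˢ posCell n c.2) E

lemma isMPB_cellPerm (n : ℕ) [NeZero n] (τ : Equiv.Perm (Fin n × Fin n)) :
    IsMPB (cellPerm n τ) :=
  ⟨measurePreserving_cellPerm n τ, cellPerm n τ.symm, measurePreserving_cellPerm n τ.symm,
    cellPerm_symm_cellPerm τ, fun u => by simpa using cellPerm_symm_cellPerm τ.symm u⟩

lemma abs_sub_le_of_Qn_eq {s : ℕ} (hs : 0 < s) {x y : UI} (hx : 0 < (x : ℝ)) (hy : 0 < (y : ℝ))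
    (h : Qn s (x : ℝ) = Qn s (y : ℝ)) : |(x : ℝ) - y| ≤ 1 / s := by
  have : NeZero s := ⟨hs.ne'⟩
  have h1 : x ∈ posCell s (cellIdx s x) := mem_posCell_iff.2 ⟨hx, rfl⟩
  have h2 : y ∈ posCell s (cellIdx s x) := mem_posCell_iff.2 ⟨hy, (cellIdx_eq_iff.2 h).symm⟩
  have h3 : (((cellIdx s x : Fin s) : ℝ) + 1) / s = (cellIdx s x : Fin s) / s + 1 / s := by ring
  have h4 := h1.1
  have h5 := h1.2
  have h6 := h2.1
  have h7 := h2.2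
  rw [abs_le]
  constructor <;> linarith

lemma shiftOf_cellPerm_le {n : ℕ} [NeZero n] (τ : Equiv.Perm (Fin n × Fin n)) {s : ℕ}
    (hs : 0 < s)
    (h : ∀ u : USq, u ∈ posSquare → Qn s ((cellPerm n τ u).1 : ℝ) = Qn s (u.1 : ℝ)) :
    shiftOf (cellPerm n τ) ≤ 1 / s := by
  refine ciSup_le fun u => ?_
  by_cases hu : u ∈ posSquare
  · have h' := (mem_posCell_prod_iff.1 (cellPerm_mem τ (mem_posCell_prod_iff.2 ⟨hu, (rfl : gridCell n u = gridCell n u)⟩))).1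
    exact abs_sub_le_of_Qn_eq hs hu.1 h'.1 (h u hu).symm
  · rw [cellPerm, if_neg hu, sub_self, abs_zero]
    positivity

lemma tsub_le_tsub_add_of_add_eq {a b c d : ℕ} (h : c + d = b) : a - c ≤ a - b + d := by omega

lemma le_add_of_compl_le_add {a a' b b' n D : ℕ} (h : a' ≤ b' + D) (ha : a + a' = n)
    (hb : b + b' = n) : b ≤ a + D := by omega

lemma exists_labeling_of_min {α Λ ι : Type*} [Fintype α] [Fintype Λ] (L : α → Λ) (p : α → ι)
    (q : Λ → ι) (n : Λ → ℕ) (hn : ∀ l, n l ≤ Fintype.card {c // L c = l ∧ p c = q l}) :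
    ∃ L' : α → Λ ⊕ ι, (∀ c, Sum.elim q id (L' c) = p c) ∧ (∀ c l, L' c = Sum.inl l → L c = l) ∧
      ∀ l, (Finset.univ.filter fun c => L' c = Sum.inl l).card = n l := by
  have h : ∀ l, ∃ A : Finset α, A ⊆ (Finset.univ.filter fun c => L c = l ∧ p c = q l) ∧
      A.card = n l := fun l => Finset.exists_subset_card_eq (by
    rw [← Fintype.card_subtype]; exact hn l)
  choose A hA hAn using h
  have hmem : ∀ {c l}, c ∈ A l → L c = l ∧ p c = q l := fun hc => by
    simpa using hA _ hc
  refine ⟨fun c => if c ∈ A (L c) then Sum.inl (L c) else Sum.inr (p c), fun c => ?_,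
    fun c l hc => ?_, fun l => ?_⟩
  · by_cases hc : c ∈ A (L c)
    · simp [hc, (hmem hc).2]
    · simp [hc]
  · by_cases h' : c ∈ A (L c)
    · simpa [h'] using hc
    · simp [h'] at hc
  · rw [← hAn l]
    congr 1
    ext c
    rw [Finset.mem_filter_univ]
    change (if c ∈ A (L c) then Sum.inl (L c) else Sum.inr (p c)) = Sum.inl l ↔ c ∈ A l
    by_cases h' : c ∈ A (L c)
    · rw [if_pos h', Sum.inl.injEq]
      exact ⟨fun h => h ▸ h', fun h => (hmem h).1⟩
    · rw [if_neg h']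
      refine ⟨fun h => absurd h Sum.inr_ne_inl, fun h => ?_⟩
      have := (hmem h).1
      subst this
      exact absurd h h'

lemma exists_perm_agreeing {α Λ ι : Type*} [Fintype α] [Fintype Λ] [Fintype ι] (L M : α → Λ)
    (p : α → ι) (q : Λ → ι) (hL : ∀ c, q (L c) = p c) :
    ∃ τ : Equiv.Perm α, (∀ c, p (τ c) = p c) ∧
      (Finset.univ.filter fun c => L c ≠ M (τ c)).card ≤
        ∑ l, ((Finset.univ.filter fun c => L c = l).card
          - (Finset.univ.filter fun c => M c = l ∧ p c = q l).card) := by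
  have haL : ∀ l, (Finset.univ.filter fun c => L c = l ∧ p c = q l)
      = Finset.univ.filter fun c => L c = l := fun l => Finset.filter_congr fun c _ =>
    ⟨And.left, fun h => ⟨h, by rw [← hL c, h]⟩⟩
  set a : Λ → ℕ := fun l => (Finset.univ.filter fun c => L c = l).card with ha
  set b : Λ → ℕ := fun l => (Finset.univ.filter fun c => M c = l ∧ p c = q l).card with hb
  obtain ⟨L', hL'p, hL'L, hL'n⟩ := exists_labeling_of_min L p q (fun l => min (a l) (b l))
    (fun l => by rw [Fintype.card_subtype, haL]; exact min_le_left _ _)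
  obtain ⟨M', hM'p, hM'M, hM'n⟩ := exists_labeling_of_min M p q (fun l => min (a l) (b l))
    (fun l => by rw [Fintype.card_subtype]; exact min_le_right _ _)
  have hdec : ∀ (K : α → Λ ⊕ ι), (∀ c, Sum.elim q id (K c) = p c) → ∀ j,
      (Finset.univ.filter fun c => p c = j).card =
        (∑ l, if q l = j then (Finset.univ.filter fun c => K c = Sum.inl l).card else 0)
          + (Finset.univ.filter fun c => K c = Sum.inr j).card := by
    intro K hK j
    rw [Finset.card_eq_sum_card_fiberwise (t := Finset.univ) (f := K) (fun _ _ => by simp),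
      Fintype.sum_sum_type]
    congr 1
    · refine Finset.sum_congr rfl fun l _ => ?_
      rw [Finset.filter_filter]
      split_ifs with h
      · congr 1
        refine Finset.filter_congr fun c _ => ⟨And.right, fun h' => ⟨?_, h'⟩⟩
        rw [← hK c, h', Sum.elim_inl, h]
      · rw [Finset.card_eq_zero, Finset.filter_eq_empty_iff]
        rintro c - ⟨h1, h2⟩
        rw [← hK c, h2, Sum.elim_inl] at h1
        exact h h1
    · rw [Finset.sum_eq_single j]
      · rw [Finset.filter_filter]
        congr 1
        refine Finset.filter_congr fun c _ => ⟨And.right, fun h' => ⟨?_, h'⟩⟩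
        rw [← hK c, h', Sum.elim_inr, id]
      · intro i _ hij
        rw [Finset.filter_filter, Finset.card_eq_zero, Finset.filter_eq_empty_iff]
        rintro c - ⟨h1, h2⟩
        rw [← hK c, h2, Sum.elim_inr] at h1
        exact hij h1
      · simp
  have hfib : ∀ x : Λ ⊕ ι, Fintype.card {c // L' c = x} = Fintype.card {c // M' c = x} := by
    intro x
    rw [Fintype.card_subtype, Fintype.card_subtype]
    rcases x with l | j
    · rw [hL'n, hM'n]
    · have h1 := hdec L' hL'p j
      have h2 := hdec M' hM'p j
      simp only [hL'n] at h1
      simp only [hM'n] at h2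
      omega
  let τ : Equiv.Perm α := Equiv.ofFiberEquiv fun x => Fintype.equivOfCardEq (hfib x)
  have hτ : ∀ c, M' (τ c) = L' c := fun c => Equiv.ofFiberEquiv_map _ c
  refine ⟨τ, fun c => by rw [← hM'p, hτ, hL'p], ?_⟩
  calc (Finset.univ.filter fun c => L c ≠ M (τ c)).card
      ≤ (Finset.univ.filter fun c => ¬ L' c = Sum.inl (L c)).card := by
        refine Finset.card_le_card fun c hc => ?_
        rw [Finset.mem_filter_univ] at hc ⊢
        intro h
        exact hc (hM'M _ _ (by rw [hτ, h])).symm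
    _ = ∑ l, (Finset.univ.filter fun c => L c = l ∧ ¬ L' c = Sum.inl l).card := by
        rw [Finset.card_eq_sum_card_fiberwise (t := Finset.univ) (f := L) (fun _ _ => by simp)]
        refine Finset.sum_congr rfl fun l _ => ?_
        rw [Finset.filter_filter]
        congr 1
        refine Finset.filter_congr fun c _ => ?_
        constructor
        · rintro ⟨h1, rfl⟩; exact ⟨rfl, h1⟩
        · rintro ⟨rfl, h1⟩; exact ⟨h1, rfl⟩
    _ ≤ ∑ l, (a l - b l) := by
        refine Finset.sum_le_sum fun l _ => ?_
        have h := Finset.card_filter_add_card_filter_not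
          (s := Finset.univ.filter fun c => L c = l) (fun c => L' c = Sum.inl l)
        rw [Finset.filter_filter, Finset.filter_filter] at h
        have h2 : (Finset.univ.filter fun c => L c = l ∧ L' c = Sum.inl l)
            = Finset.univ.filter fun c => L' c = Sum.inl l :=
          Finset.filter_congr fun c _ => ⟨And.right, fun h => ⟨hL'L c l h, h⟩⟩
        rw [h2, hL'n] at h
        simp only [ha] at h ⊢
        omega

lemma card_filter_comp {α Λ : Type*} [Fintype α] [Fintype Λ] (M : α → Λ) (P : Λ → Prop) :
    (Finset.univ.filter fun c => P (M c)).card =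
      ∑ l ∈ Finset.univ.filter P, (Finset.univ.filter fun c => M c = l).card := by
  rw [Finset.card_eq_sum_card_fiberwise (t := Finset.univ.filter P) (f := M) (fun c hc => by
    simpa using hc)]
  refine Finset.sum_congr rfl fun l hl => ?_
  rw [Finset.filter_filter]
  congr 1
  refine Finset.filter_congr fun c _ => ⟨And.right, fun h => ⟨?_, h⟩⟩
  rw [h]; simpa using hl

lemma card_filter_comp_le {α Λ : Type*} [Fintype α] [Fintype Λ] (L M : α → Λ) (P : Λ → Prop) :
    (Finset.univ.filter fun c => P (L c)).card ≤ (Finset.univ.filter fun c => P (M c)).card +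
      ∑ l, ((Finset.univ.filter fun c => L c = l).card
        - (Finset.univ.filter fun c => M c = l).card) := by
  rw [card_filter_comp, card_filter_comp]
  refine le_trans ?_ (Nat.add_le_add_left (Finset.sum_le_sum_of_subset (Finset.filter_subset P _)) _)
  rw [← Finset.sum_add_distrib]
  exact Finset.sum_le_sum fun l _ => by omega

lemma card_symmDiff_nested_le {α : Type*} [Fintype α] (P Q : α → Prop) {D : ℕ}
    (hnest : (∀ c, P c → Q c) ∨ ∀ c, Q c → P c)
    (h1 : (Finset.univ.filter P).card ≤ (Finset.univ.filter Q).card + D)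
    (h2 : (Finset.univ.filter Q).card ≤ (Finset.univ.filter P).card + D) :
    (Finset.univ.filter fun c => ¬ (P c ↔ Q c)).card ≤ D := by
  have key : ∀ P Q : α → Prop, (∀ c, P c → Q c) →
      (Finset.univ.filter Q).card ≤ (Finset.univ.filter P).card + D →
      (Finset.univ.filter fun c => ¬ (P c ↔ Q c)).card ≤ D := by
    intro P Q h h2
    have h3 := Finset.card_filter_add_card_filter_not (s := Finset.univ.filter Q) P
    rw [Finset.filter_filter, Finset.filter_filter] at h3
    have h4 : (Finset.univ.filter fun c => Q c ∧ P c) = Finset.univ.filter P :=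
      Finset.filter_congr fun c _ => ⟨And.right, fun hp => ⟨h c hp, hp⟩⟩
    have h5 : (Finset.univ.filter fun c => Q c ∧ ¬ P c)
        = Finset.univ.filter fun c => ¬ (P c ↔ Q c) :=
      Finset.filter_congr fun c _ => by have := h c; tauto
    rw [h4, h5] at h3
    omega
  rcases hnest with h | h
  · exact key P Q h h2
  · have := key Q P h h1
    simpa only [iff_comm] using this

lemma card_ne_le_of_monotone {α Λ : Type*} [Fintype α] [Fintype Λ] {s : ℕ} (L M : α → Λ)
    (q : Λ → Fin s) (hmono : ∀ c d, q (L c) < q (L d) → q (M c) ≤ q (M d)) :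
    (Finset.univ.filter fun c => q (L c) ≠ q (M c)).card ≤
      s * ∑ l, ((Finset.univ.filter fun c => L c = l).card
        - (Finset.univ.filter fun c => M c = l).card) := by
  set D := ∑ l, ((Finset.univ.filter fun c => L c = l).card
        - (Finset.univ.filter fun c => M c = l).card) with hD
  have hj : ∀ j : Fin s, (Finset.univ.filter fun c => ¬ (q (L c) ≤ j ↔ q (M c) ≤ j)).card ≤ D := by
    intro j
    convert card_symmDiff_nested_le (fun c => q (L c) ≤ j) (fun c => q (M c) ≤ j) (D := D) ?_
      (by convert card_filter_comp_le L M fun l => q l ≤ j) ?_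
    · by_contra! h
      obtain ⟨⟨c, hc, hc'⟩, d, hd, hd'⟩ := h
      exact absurd (hmono c d (lt_of_le_of_lt hc hd')) (not_le.2 (lt_of_le_of_lt hd hc'))
    · have h := card_filter_comp_le L M fun l => ¬ q l ≤ j
      refine le_add_of_compl_le_add h (n := (Finset.univ : Finset α).card) ?_ ?_ <;>
      convert Finset.card_filter_add_card_filter_not _
  calc (Finset.univ.filter fun c => q (L c) ≠ q (M c)).card
      ≤ (Finset.univ.biUnion fun j : Fin s =>
          Finset.univ.filter fun c => ¬ (q (L c) ≤ j ↔ q (M c) ≤ j)).card := by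
        refine Finset.card_le_card fun c hc => ?_
        rw [Finset.mem_filter_univ] at hc
        simp only [Finset.mem_biUnion, Finset.mem_univ, true_and, Finset.mem_filter]
        rcases lt_or_gt_of_ne hc with h | h
        · exact ⟨q (L c), fun h' => absurd (h'.1 le_rfl) (not_le.2 h)⟩
        · exact ⟨q (M c), fun h' => absurd (h'.2 le_rfl) (not_le.2 h)⟩
    _ ≤ ∑ _j : Fin s, D := Finset.card_biUnion_le.trans (Finset.sum_le_sum fun j _ => hj j)
    _ = s * D := by simp

/-- Two labelings with compatible strips are matched, up to few exceptions, by a permutation that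
preserves the strips. -/
lemma exists_strip_perm {α Λ : Type*} [Fintype α] [Fintype Λ] {s : ℕ} (L M : α → Λ)
    (q : Λ → Fin s) (hmono : ∀ c d, q (L c) < q (L d) → q (M c) ≤ q (M d)) :
    ∃ τ : Equiv.Perm α, (∀ c, q (L (τ c)) = q (L c)) ∧
      (Finset.univ.filter fun c => L c ≠ M (τ c)).card ≤
        (s + 1) * ∑ l, ((Finset.univ.filter fun c => L c = l).card
          - (Finset.univ.filter fun c => M c = l).card) := by
  obtain ⟨τ, hτ, hcard⟩ := exists_perm_agreeing L M (fun c => q (L c)) q fun _ => rfl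
  refine ⟨τ, hτ, hcard.trans ?_⟩
  have hsum : ∑ l, (Finset.univ.filter fun c => M c = l ∧ ¬ q (L c) = q l).card =
      (Finset.univ.filter fun c => q (L c) ≠ q (M c)).card := by
    rw [Finset.card_eq_sum_card_fiberwise (t := Finset.univ) (f := M) (fun _ _ => by simp)]
    refine Finset.sum_congr rfl fun l _ => ?_
    rw [Finset.filter_filter]
    congr 1
    refine Finset.filter_congr fun c _ => ?_
    constructor
    · rintro ⟨rfl, h1⟩; exact ⟨h1, rfl⟩
    · rintro ⟨h1, rfl⟩; exact ⟨rfl, h1⟩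
  rw [add_mul, one_mul, add_comm]
  refine le_trans ?_ (Nat.add_le_add_left (card_ne_le_of_monotone L M q hmono) _)
  rw [← hsum, ← Finset.sum_add_distrib]
  refine Finset.sum_le_sum fun l _ => ?_
  refine tsub_le_tsub_add_of_add_eq ?_
  convert Finset.card_filter_add_card_filter_not
    (s := Finset.univ.filter fun c => M c = l) (fun c => q (L c) = q l) using 3 <;>
  (simp only [Finset.filter_filter]; try congr!)

lemma volume_real_gridCell_mem {n : ℕ} [NeZero n] (C : Finset (Fin n × Fin n)) :
    volume.real {u : USq | gridCell n u ∈ C} = C.card / (n : ℝ) ^ 2 := by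
  have hC : MeasurableSet {u : USq | gridCell n u ∈ C} :=
    measurable_gridCell n (Finset.measurableSet C)
  have hterm : ∀ c : Fin n × Fin n,
      (volume.restrict (posCell n c.1 ×ˢ posCell n c.2)) {u : USq | gridCell n u ∈ C} =
        if c ∈ C then ENNReal.ofReal (1 / (n : ℝ) ^ 2) else 0 := by
    intro c
    rw [Measure.restrict_apply hC]
    split_ifs with hc
    · rw [← volume_cell c]
      congr 1
      refine Set.inter_eq_right.2 fun u hu => ?_
      rw [Set.mem_ofPred_eq, (mem_posCell_prod_iff.1 hu).2]
      exact hc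
    · rw [show {u : USq | gridCell n u ∈ C} ∩ posCell n c.1 ×ˢ posCell n c.2 = ∅ from ?_,
        measure_empty]
      refine Set.eq_empty_of_forall_notMem fun u hu => hc ?_
      have := hu.1
      rwa [Set.mem_ofPred_eq, (mem_posCell_prod_iff.1 hu.2).2] at this
  rw [Measure.real, volume_eq_sum_cells n, Measure.sum_apply _ hC]
  simp only [hterm]
  rw [tsum_fintype, Finset.sum_ite_mem, Finset.univ_inter, Finset.sum_const, nsmul_eq_mul,
    ENNReal.toReal_mul, ENNReal.toReal_natCast, ENNReal.toReal_ofReal (by positivity)]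
  ring

lemma volume_real_cellIdx_mem {k : ℕ} [NeZero k] (I : Finset (Fin k)) :
    volume.real {u : USq | cellIdx k u.1 ∈ I} = I.card / (k : ℝ) := by
  have h := volume_real_gridCell_mem (n := k) (I ×ˢ (Finset.univ : Finset (Fin k)))
  have hset : {u : USq | cellIdx k u.1 ∈ I} =
      {u : USq | gridCell k u ∈ I ×ˢ (Finset.univ : Finset (Fin k))} := by
    ext u
    simp [gridCell]
  have hk : (k : ℝ) ≠ 0 := Nat.cast_ne_zero.2 (NeZero.ne k)
  rw [hset, h, Finset.card_product, Finset.card_univ, Fintype.card_fin, Nat.cast_mul]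
  field_simp

lemma sum_mul_le_sum_pos {ι : Type*} [Fintype ι] (r α : ι → ℝ) {a : ℝ} (h0 : ∀ i, 0 ≤ α i)
    (h1 : ∀ i, α i ≤ a) :
    ∑ i, α i * r i ≤ a * ∑ i ∈ Finset.univ.filter (fun i => 0 < r i), r i := by
  rw [Finset.mul_sum, Finset.sum_filter]
  refine Finset.sum_le_sum fun i _ => ?_
  split_ifs with h
  · exact mul_le_mul_of_nonneg_right (h1 i) h.le
  · exact mul_nonpos_of_nonneg_of_nonpos (h0 i) (not_lt.1 h)

lemma sum_weighted_le {k : ℕ} (A : Fin k → Fin k → ℝ) (α β : Fin k → ℝ) {a K : ℝ} (ha : 0 ≤ a)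
    (hα0 : ∀ i, 0 ≤ α i) (hα : ∀ i, α i ≤ a) (hβ0 : ∀ i, 0 ≤ β i) (hβ : ∀ i, β i ≤ a)
    (hA : ∀ S T : Finset (Fin k), ∑ i ∈ S, ∑ j ∈ T, A i j ≤ K) :
    ∑ i, ∑ j, A i j * (α i * β j) ≤ a * (a * K) := by
  have e1 : ∑ i, ∑ j, A i j * (α i * β j) = ∑ i, α i * ∑ j, A i j * β j := by
    refine Finset.sum_congr rfl fun i _ => ?_
    rw [Finset.mul_sum]
    exact Finset.sum_congr rfl fun j _ => by ring
  rw [e1]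
  refine (sum_mul_le_sum_pos _ α hα0 hα).trans (mul_le_mul_of_nonneg_left ?_ ha)
  set S := Finset.univ.filter fun i => 0 < ∑ j, A i j * β j
  have e2 : ∑ i ∈ S, ∑ j, A i j * β j = ∑ j, β j * ∑ i ∈ S, A i j := by
    rw [Finset.sum_comm]
    refine Finset.sum_congr rfl fun j _ => ?_
    rw [Finset.mul_sum]
    exact Finset.sum_congr rfl fun i _ => by ring
  rw [e2]
  refine (sum_mul_le_sum_pos _ β hβ0 hβ).trans (mul_le_mul_of_nonneg_left ?_ ha)
  rw [Finset.sum_comm]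
  exact hA _ _

/-- The cut norm of a block kernel is controlled by the rectangle sums of its matrix. -/
lemma setIntegral_block_le {k : ℕ} [NeZero k] (A : Fin k → Fin k → ℝ) {κ : ℝ}
    (hA : ∀ S T : Finset (Fin k), ∑ i ∈ S, ∑ j ∈ T, A i j ≤ (k : ℝ) ^ 2 * κ)
    (S T : Set USq) :
    ∫ z in S ×ˢ T, A (cellIdx k z.1.1) (cellIdx k z.2.1) ≤ κ := by
  have hk : (0 : ℝ) < k := Nat.cast_pos.2 (NeZero.pos k)
  let P : Fin k → Set USq := fun i => {u | cellIdx k u.1 ∈ ({i} : Finset (Fin k))}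
  have hP : ∀ i, MeasurableSet (P i) := fun i =>
    ((measurable_cellIdx k).comp measurable_fst) (Finset.measurableSet {i})
  have hdec : ∀ z : USq × USq, A (cellIdx k z.1.1) (cellIdx k z.2.1) =
      ∑ i, ∑ j, A i j * (P i ×ˢ P j).indicator (1 : USq × USq → ℝ) z := by
    intro z
    rw [Finset.sum_eq_single (cellIdx k z.1.1), Finset.sum_eq_single (cellIdx k z.2.1)]
    · simp [P]
    · intro j _ hj
      simp [P, hj.symm]
    · simp
    · intro i _ hi
      refine Finset.sum_eq_zero fun j _ => ?_
      simp [P, hi.symm]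
    · simp
  have hinteg : ∀ i j, Integrable (fun z => A i j * (P i ×ˢ P j).indicator (1 : USq × USq → ℝ) z)
      ((volume : Measure (USq × USq)).restrict (S ×ˢ T)) := fun i j =>
    ((integrable_const (1 : ℝ)).indicator ((hP i).prod (hP j))).const_mul (A i j)
  simp only [hdec]
  rw [integral_finsetSum _ fun i _ => integrable_finsetSum _ fun j _ => hinteg i j]
  simp only [fun i => integral_finsetSum (Finset.univ : Finset (Fin k)) fun j _ => hinteg i j]
  have hval : ∀ i j, ∫ z in S ×ˢ T, A i j * (P i ×ˢ P j).indicator (1 : USq × USq → ℝ) z =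
      A i j * (volume.real (P i ∩ S) * volume.real (P j ∩ T)) := by
    intro i j
    rw [integral_const_mul, integral_indicator_one ((hP i).prod (hP j)), Measure.real,
      Measure.restrict_apply ((hP i).prod (hP j)), Set.prod_inter_prod, Measure.volume_eq_prod,
      Measure.prod_prod, ENNReal.toReal_mul]
    rfl
  simp only [hval]
  have hle : ∀ (i : Fin k) (R : Set USq), volume.real (P i ∩ R) ≤ 1 / k := by
    intro i R
    refine (measureReal_mono Set.inter_subset_left).trans_eq ?_
    rw [volume_real_cellIdx_mem, Finset.card_singleton, Nat.cast_one]
  refine (sum_weighted_le A _ _ (a := 1 / k) (by positivity) (fun i => measureReal_nonneg)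
    (fun i => hle i S) (fun j => measureReal_nonneg) (fun j => hle j T) hA).trans_eq ?_
  field_simp

lemma abs_setIntegral_block_le {k : ℕ} [NeZero k] (A : Fin k → Fin k → ℝ) {κ : ℝ}
    (hA : ∀ S T : Finset (Fin k), |∑ i ∈ S, ∑ j ∈ T, A i j| ≤ (k : ℝ) ^ 2 * κ)
    (S T : Set USq) :
    |∫ z in S ×ˢ T, A (cellIdx k z.1.1) (cellIdx k z.2.1)| ≤ κ := by
  refine abs_le'.2 ⟨setIntegral_block_le A (fun S T => (le_abs_self _).trans (hA S T)) S T, ?_⟩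
  rw [← integral_neg]
  refine setIntegral_block_le (fun i j => -A i j) (fun S T => ?_) S T
  simp only [Finset.sum_neg_distrib]
  exact (neg_le_abs _).trans (hA S T)

lemma cutNorm_le {U : USq → USq → ℝ} {κ : ℝ}
    (h : ∀ S T : Set USq, MeasurableSet S → MeasurableSet T →
      |∫ p in S ×ˢ T, U p.1 p.2| ≤ κ) : cutNorm U ≤ κ := by
  refine csSup_le ⟨_, ∅, ∅, MeasurableSet.empty, MeasurableSet.empty, rfl⟩ ?_
  rintro _ ⟨S, T, hS, hT, rfl⟩
  exact h S T hS hT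

lemma csDist_le {W U : USq → USq → ℝ} {f : USq → USq} (hf : IsMPB f) {a b : ℝ}
    (ha : shiftOf f ≤ a) (hb : cutNorm (fun u v => W u v - U (f u) (f v)) ≤ b) :
    csDist W U ≤ a + b := by
  have hbdd : BddBelow {x | ∃ f : USq → USq, IsMPB f ∧
      x = shiftOf f + cutNorm (fun u v => W u v - U (f u) (f v))} := by
    refine ⟨0, ?_⟩
    rintro _ ⟨g, -, rfl⟩
    refine add_nonneg (Real.iSup_nonneg fun u => abs_nonneg _) (Real.sSup_nonneg ?_)
    rintro _ ⟨S, T, -, -, rfl⟩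
    exact abs_nonneg _
  exact (csInf_le hbdd ⟨f, hf, rfl⟩).trans (add_le_add ha hb)

lemma graphOrderon_apply {k : ℕ} [NeZero k] (G : SimpleGraph (Fin k)) (u v : USq) :
    graphOrderon G u v = if G.Adj (cellIdx k u.1) (cellIdx k v.1) then 1 else 0 := by
  have h : Qn k (u.1 : ℝ) - 1 < k ∧ Qn k (v.1 : ℝ) - 1 < k :=
    ⟨(cellIdx k u.1).2, (cellIdx k v.1).2⟩
  rw [graphOrderon, blockOrderon, graphAdjFun, dif_pos h]
  rfl

lemma setIntegral_comp_cellPerm {n : ℕ} [NeZero n] (τ : Equiv.Perm (Fin n × Fin n))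
    (φ : USq → USq → ℝ) (S T : Set USq) :
    ∫ z in S ×ˢ T, φ (cellPerm n τ z.1) (cellPerm n τ z.2) =
      ∫ z in (cellPerm n τ.symm ⁻¹' S) ×ˢ (cellPerm n τ.symm ⁻¹' T), φ z.1 z.2 := by
  have hr : ∀ u, cellPerm n τ (cellPerm n τ.symm u) = u := fun u => by
    simpa using cellPerm_symm_cellPerm τ.symm u
  let e : USq ≃ᵐ USq :=
    { toFun := cellPerm n τ
      invFun := cellPerm n τ.symm
      left_inv := cellPerm_symm_cellPerm τ
      right_inv := hr
      measurable_toFun := measurable_cellPerm n τ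
      measurable_invFun := measurable_cellPerm n τ.symm }
  have hmp : MeasurePreserving (Prod.map (cellPerm n τ) (cellPerm n τ))
      (volume : Measure (USq × USq)) volume :=
    (measurePreserving_cellPerm n τ).prod (measurePreserving_cellPerm n τ)
  have hemb : MeasurableEmbedding (Prod.map (cellPerm n τ) (cellPerm n τ)) :=
    (e.prodCongr e).measurableEmbedding
  rw [← hmp.setIntegral_preimage_emb hemb (fun z => φ z.1 z.2)]
  have : S ×ˢ T = Prod.map (cellPerm n τ) (cellPerm n τ) ⁻¹'
      ((cellPerm n τ.symm ⁻¹' S) ×ˢ (cellPerm n τ.symm ⁻¹' T)) := by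
    ext z
    simp [cellPerm_symm_cellPerm]
  rw [← this]
  rfl

lemma exists_gridCell_eq {n : ℕ} (c : Fin n × Fin n) [NeZero n] : ∃ u : USq, gridCell n u = c := by
  have hne : ∀ i : Fin n, (posCell n i).Nonempty := fun i => by
    have h : (Subtype.val '' posCell n i : Set ℝ).Nonempty := by
      rw [image_posCell, Set.nonempty_Ioc]
      have : (0 : ℝ) < n := Nat.cast_pos.2 i.pos
      gcongr
      linarith
    exact h.of_image
  obtain ⟨x, hx⟩ := hne c.1
  obtain ⟨y, hy⟩ := hne c.2
  exact ⟨(x, y), (mem_posCell_prod_iff.1 (⟨hx, hy⟩ : ((x, y) : USq) ∈ posCell n c.1 ×ˢ posCell n c.2)).2⟩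

/-- A function of the square that is constant on the cells of a grid descends to the cells. -/
lemma exists_factor_gridCell {β : Type*} (n : ℕ) [NeZero n] (F : USq → β)
    (hF : ∀ u v, gridCell n u = gridCell n v → F u = F v) :
    ∃ L : Fin n × Fin n → β, ∀ u, L (gridCell n u) = F u := by
  choose rep hrep using fun c : Fin n × Fin n => exists_gridCell_eq c
  exact ⟨fun c => F (rep c), fun u => hF _ _ (hrep _)⟩

lemma gridCell_eq_iff {n : ℕ} [NeZero n] {u v : USq} : gridCell n u = gridCell n v ↔
    Qn n (u.1 : ℝ) = Qn n (v.1 : ℝ) ∧ Qn n (u.2 : ℝ) = Qn n (v.2 : ℝ) := by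
  rw [gridCell, gridCell, Prod.ext_iff, cellIdx_eq_iff, cellIdx_eq_iff]

lemma card_filter_eq_volume {Λ : Type*} {n : ℕ} [NeZero n] (F : USq → Λ)
    (L : Fin n × Fin n → Λ) (hL : ∀ u, L (gridCell n u) = F u) (l : Λ) :
    ((Finset.univ.filter fun c => L c = l).card : ℝ) = n ^ 2 * volume.real {u | F u = l} := by
  have hn : (n : ℝ) ≠ 0 := Nat.cast_ne_zero.2 (NeZero.ne n)
  have h := volume_real_gridCell_mem (Finset.univ.filter fun c => L c = l)
  have hset : {u | gridCell n u ∈ Finset.univ.filter fun c => L c = l} = {u | F u = l} := by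
    ext u
    simp [hL]
  rw [← hset, h]
  field_simp

lemma volume_real_cellIdx_comp {Λ : Type*} {k : ℕ} [NeZero k] (F : Fin k → Λ) (l : Λ) :
    volume.real {u : USq | F (cellIdx k u.1) = l} =
      (Finset.univ.filter fun i => F i = l).card / (k : ℝ) := by
  rw [← volume_real_cellIdx_mem]
  congr 1
  ext u
  simp

lemma abs_setIntegral_sub_le_of_agree {n : ℕ} [NeZero n] (A B : USq → USq → ℝ)
    (hA : Measurable (Function.uncurry A)) (hB : Measurable (Function.uncurry B)) {b : ℝ}
    (hAb : ∀ u v, |A u v| ≤ b) (hBb : ∀ u v, |B u v| ≤ b) (C : Finset (Fin n × Fin n))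
    (hagree : ∀ u v, u ∈ posSquare → v ∈ posSquare → gridCell n u ∉ C → gridCell n v ∉ C →
      A u v = B u v) (S T : Set USq) :
    |∫ z in S ×ˢ T, (A z.1 z.2 - B z.1 z.2)| ≤ 4 * b * (C.card / (n : ℝ) ^ 2) := by
  have hb0 : 0 ≤ b := (abs_nonneg _).trans (hAb (0, 0) (0, 0))
  let D : Set USq := {u | gridCell n u ∈ C}
  have hD : MeasurableSet D := measurable_gridCell n (Finset.measurableSet C)
  have hDv : volume.real D = C.card / (n : ℝ) ^ 2 := volume_real_gridCell_mem C
  have hi1 : Integrable (fun z : USq × USq => D.indicator (1 : USq → ℝ) z.1) volume := by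
    refine Integrable.of_bound (C := 1)
      (((measurable_one.indicator hD).comp measurable_fst).aestronglyMeasurable)
      (ae_of_all _ fun z => ?_)
    have := indicator_one_mem_unit D z.1
    rw [Real.norm_eq_abs, abs_of_nonneg this.1]
    exact this.2
  have hi2 : Integrable (fun z : USq × USq => D.indicator (1 : USq → ℝ) z.2) volume := by
    refine Integrable.of_bound (C := 1)
      (((measurable_one.indicator hD).comp measurable_snd).aestronglyMeasurable)
      (ae_of_all _ fun z => ?_)
    have := indicator_one_mem_unit D z.2
    rw [Real.norm_eq_abs, abs_of_nonneg this.1]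
    exact this.2
  have hv1 : ∫ z : USq × USq, D.indicator (1 : USq → ℝ) z.1 = volume.real D := by
    change ∫ z : USq × USq, (Prod.fst ⁻¹' D).indicator (1 : USq × USq → ℝ) z = _
    rw [integral_indicator_one (measurable_fst hD), Measure.real, Measure.real,
      Measure.volume_eq_prod, measurePreserving_fst.measure_preimage hD.nullMeasurableSet]
  have hv2 : ∫ z : USq × USq, D.indicator (1 : USq → ℝ) z.2 = volume.real D := by
    change ∫ z : USq × USq, (Prod.snd ⁻¹' D).indicator (1 : USq × USq → ℝ) z = _
    rw [integral_indicator_one (measurable_snd hD), Measure.real, Measure.real,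
      Measure.volume_eq_prod, measurePreserving_snd.measure_preimage hD.nullMeasurableSet]
  have hP : ∀ᵐ z : USq × USq, z.1 ∈ posSquare ∧ z.2 ∈ posSquare := by
    have h1 : ∀ᵐ u : USq, u ∈ posSquare := mem_ae_iff.2 volume_compl_posSquare
    exact (measurePreserving_fst.quasiMeasurePreserving.ae h1).and
      (measurePreserving_snd.quasiMeasurePreserving.ae h1)
  have hdm : Measurable fun z : USq × USq => A z.1 z.2 - B z.1 z.2 := hA.sub hB
  have hdi : Integrable (fun z : USq × USq => A z.1 z.2 - B z.1 z.2) volume :=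
    Integrable.of_bound (C := b + b) hdm.aestronglyMeasurable (ae_of_all _ fun z : USq × USq =>
      (abs_sub _ _).trans (add_le_add (hAb _ _) (hBb _ _)))
  calc |∫ z in S ×ˢ T, (A z.1 z.2 - B z.1 z.2)|
      ≤ ∫ z in S ×ˢ T, |A z.1 z.2 - B z.1 z.2| := abs_integral_le_integral_abs
    _ ≤ ∫ z : USq × USq, |A z.1 z.2 - B z.1 z.2| :=
        setIntegral_le_integral hdi.abs (ae_of_all _ fun z => abs_nonneg _)
    _ ≤ ∫ z : USq × USq, 2 * b * (D.indicator (1 : USq → ℝ) z.1 + D.indicator (1 : USq → ℝ) z.2) := by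
        refine integral_mono_ae hdi.abs ((hi1.add hi2).const_mul _) ?_
        filter_upwards [hP] with z hz
        have h1 := indicator_one_mem_unit D z.1
        have h2 := indicator_one_mem_unit D z.2
        have hle : |A z.1 z.2 - B z.1 z.2| ≤ 2 * b :=
          (abs_sub _ _).trans ((add_le_add (hAb _ _) (hBb _ _)).trans_eq (by ring))
        by_cases hc1 : z.1 ∈ D
        · rw [Set.indicator_of_mem hc1]
          refine hle.trans (le_mul_of_one_le_right (by positivity) ?_)
          simpa using h2.1
        by_cases hc2 : z.2 ∈ D
        · rw [Set.indicator_of_mem hc2]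
          refine hle.trans (le_mul_of_one_le_right (by positivity) ?_)
          simpa using h1.1
        rw [hagree z.1 z.2 hz.1 hz.2 hc1 hc2, sub_self, abs_zero]
        exact mul_nonneg (by positivity) (add_nonneg h1.1 h2.1)
    _ = 4 * b * (C.card / (n : ℝ) ^ 2) := by
        rw [integral_const_mul, integral_add hi1 hi2, hv1, hv2, hDv]
        ring

lemma cellIdx_mono {n : ℕ} [NeZero n] : Monotone (cellIdx n) := fun x y h => by
  have h1 := Qn_mono n (show (x : ℝ) ≤ y from h)
  rw [← cellIdx_val, ← cellIdx_val] at h1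
  exact Fin.le_def.2 (by omega)

/-- If the label frequencies of an ordered sample are close to their expectations, and the sampled
graph is close in cut norm to a kernel depending only on the labels, then the block orderon of
the graph is close to the original orderon in cut-shift distance. -/
lemma csDist_graphOrderon_le {Λ : Type*} [Fintype Λ] {k s d : ℕ} [NeZero k] [NeZero s]
    (hd : 0 < d) {W : USq → USq → ℝ} (hW : Measurable (Function.uncurry W))
    (hW1 : ∀ u v, |W u v| ≤ 1) (lab : USq → Λ) (q : Λ → Fin s)
    (hq : ∀ u, q (lab u) = cellIdx s u.1)
    (hlab : ∀ u v : USq, Qn d (u.1 : ℝ) = Qn d (v.1 : ℝ) → Qn d (u.2 : ℝ) = Qn d (v.2 : ℝ) →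
      lab u = lab v)
    (h : Λ → Λ → ℝ) {b : ℝ} (hb : ∀ l l', |h l l'| ≤ b) {ε : ℝ}
    (hcut : ∀ A B : Set USq, MeasurableSet A → MeasurableSet B →
      |∫ z in A ×ˢ B, (W z.1 z.2 - h (lab z.1) (lab z.2))| ≤ ε)
    (x : Fin k → USq) (hx : Monotone fun i => (x i).1) (G : SimpleGraph (Fin k)) {δ : ℝ}
    (hcount : ∀ l, k * (volume.real {u | lab u = l} - δ) ≤
      ((Finset.univ.filter fun i => lab (x i) = l).card : ℝ)) (hδ : 0 ≤ δ) {κ : ℝ}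
    (hrect : ∀ S T : Finset (Fin k), |∑ i ∈ S, ∑ j ∈ T,
      (h (lab (x i)) (lab (x j)) - if G.Adj i j then 1 else 0)| ≤ (k : ℝ) ^ 2 * κ) :
    csDist W (graphOrderon G) ≤
      1 / s + (ε + 4 * b * ((s + 1) * (Fintype.card Λ * δ)) + κ) := by
  have hk : (0 : ℝ) < k := Nat.cast_pos.2 (NeZero.pos k)
  have hN : 0 < d * k := Nat.mul_pos hd (NeZero.pos k)
  obtain ⟨N, hNdef⟩ : ∃ N, N = d * k := ⟨_, rfl⟩
  rw [← hNdef] at hN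
  have : NeZero N := ⟨hN.ne'⟩
  have hN' : (0 : ℝ) < N := Nat.cast_pos.2 hN
  have hlabN : ∀ u v, gridCell N u = gridCell N v → lab u = lab v := fun u v huv => by
    rw [gridCell_eq_iff] at huv
    exact hlab u v (Qn_eq_of_dvd hN ⟨k, hNdef⟩ huv.1) (Qn_eq_of_dvd hN ⟨k, hNdef⟩ huv.2)
  have hidxN : ∀ u v : USq, gridCell N u = gridCell N v →
      lab (x (cellIdx k u.1)) = lab (x (cellIdx k v.1)) := fun u v huv => by
    rw [gridCell_eq_iff] at huv
    rw [cellIdx_eq_iff.2 (Qn_eq_of_dvd hN ⟨d, by rw [hNdef, mul_comm]⟩ huv.1)]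
  obtain ⟨L, hL⟩ := exists_factor_gridCell N lab hlabN
  obtain ⟨M, hM⟩ := exists_factor_gridCell N (fun u => lab (x (cellIdx k u.1))) hidxN
  have hmono : ∀ c c', q (L c) < q (L c') → q (M c) ≤ q (M c') := by
    intro c c' hcc
    obtain ⟨u, rfl⟩ := exists_gridCell_eq c
    obtain ⟨v, rfl⟩ := exists_gridCell_eq c'
    rw [hL, hL, hq, hq] at hcc
    rw [hM, hM, hq, hq]
    exact cellIdx_mono (hx (cellIdx_mono (cellIdx_mono.reflect_lt hcc).le))
  obtain ⟨τ, hτ, hcard⟩ := exists_strip_perm L M q hmono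
  set C := Finset.univ.filter fun c => L c ≠ M (τ c) with hC
  have hcard' : (C.card : ℝ) / (N : ℝ) ^ 2 ≤ (s + 1) * (Fintype.card Λ * δ) := by
    have hterm : ∀ l, (((Finset.univ.filter fun c => L c = l).card
        - (Finset.univ.filter fun c => M c = l).card : ℕ) : ℝ) ≤ N ^ 2 * δ := by
      intro l
      have h1 := card_filter_eq_volume lab L hL l
      have h2 := card_filter_eq_volume _ M hM l
      rw [volume_real_cellIdx_comp (fun i => lab (x i)) l] at h2
      have h3 := hcount l
      have h4 : volume.real {u | lab u = l} - δ ≤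
          ((Finset.univ.filter fun i => lab (x i) = l).card : ℝ) / k := by
        rw [le_div_iff₀ hk]; linarith
      have h5 : (N : ℝ) ^ 2 * (volume.real {u | lab u = l} - δ) ≤ (N : ℝ) ^ 2 *
          (((Finset.univ.filter fun i => lab (x i) = l).card : ℝ) / k) := by gcongr
      rcases le_total (Finset.univ.filter fun c => M c = l).card
        (Finset.univ.filter fun c => L c = l).card with h6 | h6
      · rw [Nat.cast_sub h6, h1, h2]
        linarith
      · rw [Nat.sub_eq_zero_of_le h6, Nat.cast_zero]
        positivity
    rw [div_le_iff₀ (by positivity)]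
    calc (C.card : ℝ) ≤ (((s + 1) * ∑ l, ((Finset.univ.filter fun c => L c = l).card
          - (Finset.univ.filter fun c => M c = l).card) : ℕ) : ℝ) := by exact_mod_cast hcard
      _ ≤ (s + 1) * ∑ _l : Λ, (N : ℝ) ^ 2 * δ := by
          rw [Nat.cast_mul, Nat.cast_sum]
          push_cast
          gcongr with l
          exact_mod_cast hterm l
      _ = (s + 1) * (Fintype.card Λ * δ) * N ^ 2 := by
          rw [Finset.sum_const, Finset.card_univ, nsmul_eq_mul]; ring
  have hshift : shiftOf (cellPerm N τ) ≤ 1 / s := by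
    refine shiftOf_cellPerm_le τ (NeZero.pos s) fun u hu => ?_
    rw [← cellIdx_eq_iff, ← hq, ← hq, ← hL, ← hL, gridCell_cellPerm τ hu, hτ]
  refine csDist_le (isMPB_cellPerm N τ) hshift (cutNorm_le fun S T hS hT => ?_)
  have hb0 : 0 ≤ b := (abs_nonneg _).trans (hb (lab (0, 0)) (lab (0, 0)))
  let f := cellPerm N τ
  let A : USq → USq → ℝ := fun u v => h (lab u) (lab v)
  let B : USq → USq → ℝ := fun u v => h (lab (x (cellIdx k (f u).1))) (lab (x (cellIdx k (f v).1)))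
  let E : Fin k → Fin k → ℝ := fun i j =>
    h (lab (x i)) (lab (x j)) - if G.Adj i j then 1 else 0
  have hfin : ∀ (F : Fin N × Fin N → Fin N × Fin N → ℝ) (g : USq → USq), Measurable g →
      Measurable fun z : USq × USq => F (gridCell N (g z.1)) (gridCell N (g z.2)) := by
    intro F g hg
    have hF : Measurable (Function.uncurry F) := measurable_of_countable _
    exact hF.comp ((((measurable_gridCell N).comp hg).comp measurable_fst).prodMk
      (((measurable_gridCell N).comp hg).comp measurable_snd))
  have hAm : Measurable (Function.uncurry A) := by
    have := hfin (fun c c' => h (L c) (L c')) id measurable_id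
    simp only [id, hL] at this
    exact this
  have hfm : Measurable f := measurable_cellPerm N τ
  have hBm : Measurable (Function.uncurry B) := by
    have := hfin (fun c c' => h (M c) (M c')) f hfm
    simp only [hM] at this
    exact this
  have hEm : Measurable fun z : USq × USq => E (cellIdx k (f z.1).1) (cellIdx k (f z.2).1) := by
    have hF : Measurable (Function.uncurry E) := measurable_of_countable _
    exact hF.comp (((measurable_cellIdx k).comp ((measurable_fst.comp hfm).comp measurable_fst)).prodMk
      ((measurable_cellIdx k).comp ((measurable_fst.comp hfm).comp measurable_snd)))
  have hAb : ∀ u v, |A u v| ≤ b := fun u v => hb _ _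
  have hBb : ∀ u v, |B u v| ≤ b := fun u v => hb _ _
  have hEb : ∀ i j, |E i j| ≤ b + 1 := fun i j => by
    refine (abs_sub _ _).trans (add_le_add (hb _ _) ?_)
    split_ifs <;> simp
  have hI2 := abs_setIntegral_sub_le_of_agree A B hAm hBm hAb hBb C (fun u v hu hv hcu hcv => by
    simp only [hC, Finset.mem_filter_univ, not_not] at hcu hcv
    have h1 : lab u = lab (x (cellIdx k (f u).1)) := by
      rw [← hL, hcu, ← gridCell_cellPerm τ hu, hM]
    have h2 : lab v = lab (x (cellIdx k (f v).1)) := by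
      rw [← hL, hcv, ← gridCell_cellPerm τ hv, hM]
    simp only [A, B]
    rw [← h1, ← h2]) S T
  have hI3 : |∫ z in S ×ˢ T, E (cellIdx k (f z.1).1) (cellIdx k (f z.2).1)| ≤ κ := by
    rw [setIntegral_comp_cellPerm τ (fun u v => E (cellIdx k u.1) (cellIdx k v.1)) S T]
    exact abs_setIntegral_block_le E hrect _ _
  have hi1 : Integrable (fun z : USq × USq => W z.1 z.2 - A z.1 z.2) (volume.restrict (S ×ˢ T)) :=
    Integrable.of_bound (C := 1 + b) (hW.sub hAm).aestronglyMeasurable (ae_of_all _ fun z =>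
      (abs_sub _ _).trans (add_le_add (hW1 _ _) (hAb _ _)))
  have hi2 : Integrable (fun z : USq × USq => A z.1 z.2 - B z.1 z.2) (volume.restrict (S ×ˢ T)) :=
    Integrable.of_bound (C := b + b) (hAm.sub hBm).aestronglyMeasurable (ae_of_all _ fun z =>
      (abs_sub _ _).trans (add_le_add (hAb _ _) (hBb _ _)))
  have hi3 : Integrable (fun z : USq × USq => E (cellIdx k (f z.1).1) (cellIdx k (f z.2).1))
      (volume.restrict (S ×ˢ T)) :=
    Integrable.of_bound (C := b + 1) hEm.aestronglyMeasurable (ae_of_all _ fun z => hEb _ _)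
  have hi12 : Integrable (fun z : USq × USq => (W z.1 z.2 - A z.1 z.2) + (A z.1 z.2 - B z.1 z.2))
      (volume.restrict (S ×ˢ T)) := hi1.add hi2
  have hsplit : ∀ z : USq × USq, W z.1 z.2 - graphOrderon G (f z.1) (f z.2) =
      (W z.1 z.2 - A z.1 z.2) + (A z.1 z.2 - B z.1 z.2)
        + E (cellIdx k (f z.1).1) (cellIdx k (f z.2).1) := by
    intro z
    rw [graphOrderon_apply]
    simp only [A, B, E]
    ring
  change |∫ z in S ×ˢ T, (W z.1 z.2 - graphOrderon G (f z.1) (f z.2))| ≤ _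
  simp only [hsplit]
  rw [integral_add hi12 hi3, integral_add hi1 hi2]
  refine (abs_add_le _ _).trans (add_le_add ((abs_add_le _ _).trans
    (add_le_add (hcut S T hS hT) (hI2.trans ?_))) hI3)
  gcongr

lemma measure_preimage_le_of_measurePreserving {α β : Type*} [MeasurableSpace α]
    [MeasurableSpace β] {μ : Measure α} {ν : Measure β} {f : α → β} (hf : MeasurePreserving f μ ν)
    (E : Set β) : μ (f ⁻¹' E) ≤ ν E := by
  rw [← measure_toMeasurable E,
    ← hf.measure_preimage (measurableSet_toMeasurable ν E).nullMeasurableSet]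
  exact measure_mono (Set.preimage_mono (subset_toMeasurable ν E))

lemma measurePreserving_points (k : ℕ) :
    MeasurePreserving (fun (p : (Fin k → UI) × (Fin k → UI) × (Pairs k → UI)) (i : Fin k) =>
      ((p.1 i, p.2.1 i) : USq)) volume volume := by
  have h1 : MeasurePreserving (Prod.map id Prod.fst :
      (Fin k → UI) × (Fin k → UI) × (Pairs k → UI) → (Fin k → UI) × (Fin k → UI))
      volume volume :=
    (MeasurePreserving.id (volume : Measure (Fin k → UI))).prod
      (measurePreserving_fst (μ := (volume : Measure (Fin k → UI)))
        (ν := (volume : Measure (Pairs k → UI))))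
  exact (volume_measurePreserving_arrowProdEquivProdArrow UI UI (Fin k)).symm.comp h1

lemma integral_threshold {c : ℝ} (hc : c ∈ Set.Icc (0 : ℝ) 1) :
    ∫ ξ : UI, (if (ξ : ℝ) ≤ c then (1 : ℝ) else 0) = c := by
  have h : (fun ξ : UI => if (ξ : ℝ) ≤ c then (1 : ℝ) else 0) =
      (Set.Iic (⟨c, hc⟩ : UI)).indicator 1 := by
    ext ξ
    simp [Set.indicator, ← Subtype.coe_le_coe]
  rw [h, integral_indicator_one measurableSet_Iic, Measure.real, unitInterval.volume_Iic]
  simp [hc.1]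

lemma card_Pairs_le (k : ℕ) : (Fintype.card (Pairs k) : ℝ) ≤ (k : ℝ) ^ 2 := by
  have h : Fintype.card (Pairs k) ≤ Fintype.card (Fin k × Fin k) := Fintype.card_subtype_le _
  rw [Fintype.card_prod, Fintype.card_fin] at h
  calc (Fintype.card (Pairs k) : ℝ) ≤ ((k * k : ℕ) : ℝ) := by exact_mod_cast h
    _ = (k : ℝ) ^ 2 := by push_cast; ring

lemma edge_tail {k : ℕ} {W : USq → USq → ℝ} (hW : Measurable (Function.uncurry W))
    (hW1 : ∀ u v, W u v ∈ Set.Icc (0 : ℝ) 1) (σ : Equiv.Perm (Fin k)) (w : Pairs k → ℝ)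
    (hw : ∀ e, |w e| ≤ 2) {t : ℝ} (ht : 0 < t) :
    volume {p : (Fin k → UI) × (Fin k → UI) × (Pairs k → UI) | t ≤ ∑ e : Pairs k, w e *
      ((if (p.2.2 e : ℝ) ≤ W (p.1 (σ e.1.1), p.2.1 (σ e.1.1)) (p.1 (σ e.1.2), p.2.1 (σ e.1.2))
          then 1 else 0) -
        W (p.1 (σ e.1.1), p.2.1 (σ e.1.1)) (p.1 (σ e.1.2), p.2.1 (σ e.1.2)))} ≤
      ENNReal.ofReal (Real.exp (-t ^ 2 / (2 * ((k : ℝ) ^ 2 * 2 ^ 2)))) := by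
  have hWm : ∀ e : Pairs k, Measurable fun p : (Fin k → UI) × (Fin k → UI) × (Pairs k → UI) =>
      W (p.1 (σ e.1.1), p.2.1 (σ e.1.1)) (p.1 (σ e.1.2), p.2.1 (σ e.1.2)) := by
    intro e
    have hpt : ∀ i : Fin k, Measurable fun p : (Fin k → UI) × (Fin k → UI) × (Pairs k → UI) =>
        ((p.1 i, p.2.1 i) : USq) := fun i =>
      ((measurable_pi_apply i).comp measurable_fst).prodMk
        ((measurable_pi_apply i).comp (measurable_fst.comp measurable_snd))
    exact hW.comp ((hpt _).prodMk (hpt _))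
  have hrm : ∀ e : Pairs k, Measurable fun p : (Fin k → UI) × (Fin k → UI) × (Pairs k → UI) =>
      (p.2.2 e : ℝ) := fun e =>
    measurable_subtype_coe.comp ((measurable_pi_apply e).comp (measurable_snd.comp measurable_snd))
  have hE : MeasurableSet {p : (Fin k → UI) × (Fin k → UI) × (Pairs k → UI) |
      t ≤ ∑ e : Pairs k, w e *
      ((if (p.2.2 e : ℝ) ≤ W (p.1 (σ e.1.1), p.2.1 (σ e.1.1)) (p.1 (σ e.1.2), p.2.1 (σ e.1.2))
          then 1 else 0) -
        W (p.1 (σ e.1.1), p.2.1 (σ e.1.1)) (p.1 (σ e.1.2), p.2.1 (σ e.1.2)))} := by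
    refine measurableSet_le measurable_const (Finset.measurable_fun_sum _ fun e _ => ?_)
    exact ((Measurable.ite (measurableSet_le (hrm e) (hWm e)) measurable_const
      measurable_const).sub (hWm e)).const_mul _
  refine measure_prod_le_of_sections volume volume hE fun z => ?_
  refine measure_prod_le_of_sections volume volume (measurable_prodMk_left hE) fun y => ?_
  have hh := hoeffding_pi (volume : Measure UI)
    (fun (e : Pairs k) (ξ : UI) => w e *
      if (ξ : ℝ) ≤ W (z (σ e.1.1), y (σ e.1.1)) (z (σ e.1.2), y (σ e.1.2)) then (1 : ℝ) else 0)
    (fun e => (Measurable.ite (measurableSet_le measurable_subtype_coe measurable_const)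
      measurable_const measurable_const).const_mul _) (B := 2) two_pos
    (fun e ξ => by
      rw [abs_mul]
      refine (mul_le_of_le_one_right (abs_nonneg _) ?_).trans (hw e)
      split_ifs <;> simp) (card_Pairs_le k) ht
  refine (measure_mono ?_).trans hh
  intro r hr
  change t ≤ _ at hr
  change t ≤ _
  refine hr.trans_eq (Finset.sum_congr rfl fun e _ => ?_)
  rw [integral_const_mul, integral_threshold (hW1 _ _)]
  ring

lemma sum_sum_eq_sum_pairs {k : ℕ} (f : Fin k → Fin k → ℝ) (h0 : ∀ a, f a a = 0) :
    ∑ a, ∑ b, f a b = ∑ e : Pairs k, (f e.1.1 e.1.2 + f e.1.2 e.1.1) := by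
  have hp : ∀ g : Fin k → Fin k → ℝ,
      ∑ e : Pairs k, g e.1.1 e.1.2 = ∑ a, ∑ b, if a < b then g a b else 0 := by
    intro g
    rw [← Fintype.sum_prod_type' (f := fun a b => if a < b then g a b else 0),
      ← Finset.sum_filter]
    exact (Finset.sum_subtype _ (fun x => by simp) (fun x : Fin k × Fin k => g x.1 x.2)).symm
  rw [Finset.sum_add_distrib, hp f, hp fun a b => f b a,
    Finset.sum_comm (f := fun a b => if a < b then f b a else 0), ← Finset.sum_add_distrib]
  refine Finset.sum_congr rfl fun a _ => ?_
  rw [← Finset.sum_add_distrib]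
  refine Finset.sum_congr rfl fun b _ => ?_
  rcases lt_trichotomy a b with h | h | h
  · simp [h, h.not_gt]
  · simp [h, h0]
  · simp [h, h.not_gt]

lemma sampleSG_adj_of_lt {k : ℕ} {W : USq → USq → ℝ} {z y : Fin k → UI} {r : Pairs k → UI}
    {a b : Fin k} (h : a < b) : (sampleSG k W z y r).Adj a b ↔ (r ⟨(a, b), h⟩ : ℝ) ≤
      W (z (Tuple.sort (fun t => (z t : ℝ)) a), y (Tuple.sort (fun t => (z t : ℝ)) a))
        (z (Tuple.sort (fun t => (z t : ℝ)) b), y (Tuple.sort (fun t => (z t : ℝ)) b)) := by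
  rw [sampleSG, SimpleGraph.fromRel_adj]
  constructor
  · rintro ⟨-, ⟨_, h1⟩ | ⟨h2, -⟩⟩
    · exact h1
    · exact absurd h h2.not_gt
  · exact fun h1 => ⟨h.ne, Or.inl ⟨h, h1⟩⟩

/-- Outside an exceptional set, the edge counts of the sampled graph between all pairs of vertex
sets are close to their conditional expectations given the sample points. -/
lemma exists_edge_event {k : ℕ} {W : USq → USq → ℝ} (hW : IsOrderon W) {t : ℝ}
    (ht : 0 < t) :
    ∃ E : Set ((Fin k → UI) × (Fin k → UI) × (Pairs k → UI)),
      volume E ≤ ENNReal.ofReal ((k : ℝ) ^ k * (2 * 4 ^ k) *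
        Real.exp (-t ^ 2 / (2 * ((k : ℝ) ^ 2 * 2 ^ 2)))) ∧
      ∀ p ∉ E, ∀ S T : Finset (Fin k), |∑ a ∈ S, ∑ b ∈ T, if a = b then 0 else
        (W (p.1 (Tuple.sort (fun t => (p.1 t : ℝ)) a), p.2.1 (Tuple.sort (fun t => (p.1 t : ℝ)) a))
          (p.1 (Tuple.sort (fun t => (p.1 t : ℝ)) b), p.2.1 (Tuple.sort (fun t => (p.1 t : ℝ)) b))
        - if (sampleSG k W p.1 p.2.1 p.2.2).Adj a b then 1 else 0)| ≤ t := by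
  obtain ⟨hWm, hW1, hsymm⟩ := hW
  let w : Bool × Finset (Fin k) × Finset (Fin k) → Pairs k → ℝ := fun c e =>
    (if c.1 then 1 else -1) *
      ((if e.1.1 ∈ c.2.1 then 1 else 0) * (if e.1.2 ∈ c.2.2 then 1 else 0) +
        (if e.1.2 ∈ c.2.1 then 1 else 0) * (if e.1.1 ∈ c.2.2 then 1 else 0))
  have hw : ∀ c e, |w c e| ≤ 2 := by
    intro c e
    simp only [w]
    split_ifs <;> norm_num
  let F : Equiv.Perm (Fin k) × Bool × Finset (Fin k) × Finset (Fin k) →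
      Set ((Fin k → UI) × (Fin k → UI) × (Pairs k → UI)) := fun i =>
    {p | t ≤ ∑ e : Pairs k, w i.2 e *
      ((if (p.2.2 e : ℝ) ≤ W (p.1 (i.1 e.1.1), p.2.1 (i.1 e.1.1))
          (p.1 (i.1 e.1.2), p.2.1 (i.1 e.1.2)) then 1 else 0) -
        W (p.1 (i.1 e.1.1), p.2.1 (i.1 e.1.1)) (p.1 (i.1 e.1.2), p.2.1 (i.1 e.1.2)))}
  refine ⟨⋃ i, F i, ?_, ?_⟩
  · refine (measure_iUnion_le_card volume F fun i =>
      edge_tail hWm hW1 i.1 (w i.2) (hw i.2) ht).trans ?_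
    refine ENNReal.ofReal_le_ofReal (mul_le_mul_of_nonneg_right ?_ (Real.exp_pos _).le)
    have hcard : Fintype.card (Equiv.Perm (Fin k) × Bool × Finset (Fin k) × Finset (Fin k)) =
        k.factorial * (2 * 4 ^ k) := by
      rw [Fintype.card_prod, Fintype.card_perm, Fintype.card_prod, Fintype.card_prod,
        Fintype.card_finset, Fintype.card_bool, Fintype.card_fin, ← mul_pow]
      norm_num
    rw [hcard]
    push_cast
    gcongr
    exact_mod_cast Nat.factorial_le_pow k
  · intro p hp S T
    set σ := Tuple.sort (fun t => (p.1 t : ℝ)) with hσ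
    set G := sampleSG k W p.1 p.2.1 p.2.2 with hG
    let D : Fin k → Fin k → ℝ := fun a b => if a = b then 0 else
      (W (p.1 (σ a), p.2.1 (σ a)) (p.1 (σ b), p.2.1 (σ b)) - if G.Adj a b then 1 else 0)
    have hDs : ∀ a b, D a b = D b a := fun a b => by
      simp only [D, G.adj_comm a b, eq_comm (a := a) (b := b),
        hsymm (p.1 (σ a), p.2.1 (σ a)) (p.1 (σ b), p.2.1 (σ b))]
    have hsum : ∀ s : Bool, ((if s then 1 else -1) * ∑ a ∈ S, ∑ b ∈ T, D a b : ℝ) =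
        - ∑ e : Pairs k, w (s, S, T) e *
      ((if (p.2.2 e : ℝ) ≤ W (p.1 (σ e.1.1), p.2.1 (σ e.1.1))
          (p.1 (σ e.1.2), p.2.1 (σ e.1.2)) then 1 else 0) -
        W (p.1 (σ e.1.1), p.2.1 (σ e.1.1)) (p.1 (σ e.1.2), p.2.1 (σ e.1.2))) := by
      intro s
      have h1 : ∑ a ∈ S, ∑ b ∈ T, D a b =
          ∑ a, ∑ b, (if a ∈ S then 1 else 0) * (if b ∈ T then 1 else 0) * D a b := by
        simp only [ite_mul, one_mul, zero_mul]
        simp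
      rw [h1, sum_sum_eq_sum_pairs _ (fun a => by simp [D]), Finset.mul_sum,
        ← Finset.sum_neg_distrib]
      refine Finset.sum_congr rfl fun e _ => ?_
      have hDe : D e.1.1 e.1.2 = W (p.1 (σ e.1.1), p.2.1 (σ e.1.1))
          (p.1 (σ e.1.2), p.2.1 (σ e.1.2)) - if (p.2.2 e : ℝ) ≤ W (p.1 (σ e.1.1), p.2.1 (σ e.1.1))
          (p.1 (σ e.1.2), p.2.1 (σ e.1.2)) then 1 else 0 := by
        simp only [D, if_neg e.2.ne, hG, sampleSG_adj_of_lt e.2]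
        rfl
      rw [hDs e.1.2 e.1.1, hDe]
      simp only [w]
      ring
    have hnot : ∀ s : Bool, ¬ t ≤ ∑ e : Pairs k, w (s, S, T) e *
      ((if (p.2.2 e : ℝ) ≤ W (p.1 (σ e.1.1), p.2.1 (σ e.1.1))
          (p.1 (σ e.1.2), p.2.1 (σ e.1.2)) then 1 else 0) -
        W (p.1 (σ e.1.1), p.2.1 (σ e.1.1)) (p.1 (σ e.1.2), p.2.1 (σ e.1.2))) := fun s hs =>
      hp (Set.mem_iUnion.2 ⟨(σ, s, S, T), hs⟩)
    have ht1 := hsum true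
    have ht2 := hsum false
    have hn1 := hnot true
    have hn2 := hnot false
    simp only [if_true, Bool.false_eq_true, if_false] at ht1 ht2
    change |∑ a ∈ S, ∑ b ∈ T, D a b| ≤ t
    rw [abs_le]
    constructor <;> linarith

lemma exists_label_event {Λ X : Type*} [Fintype Λ] [MeasurableSpace X] (μ : Measure X)
    [IsProbabilityMeasure μ] (lab : X → Λ) (hlab : ∀ l, MeasurableSet {u | lab u = l}) {k : ℕ}
    (hk : 0 < k) {δ : ℝ} (hδ : 0 < δ) :
    ∃ E : Set (Fin k → X), Measure.pi (fun _ => μ) E ≤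
        ENNReal.ofReal (Fintype.card Λ * Real.exp (-(k * δ) ^ 2 / (2 * (k * 1 ^ 2)))) ∧
      ∀ x ∉ E, ∀ l, k * (μ.real {u | lab u = l} - δ) ≤
        ((Finset.univ.filter fun i => lab (x i) = l).card : ℝ) := by
  have hk' : (0 : ℝ) < k := Nat.cast_pos.2 hk
  let h : Λ → X → ℝ := fun l u => -({u | lab u = l}.indicator (1 : X → ℝ) u)
  have hm : ∀ l, Measurable (h l) := fun l => (measurable_one.indicator (hlab l)).neg
  refine ⟨⋃ l, {x | k * δ ≤ ∑ i : Fin k, (h l (x i) - ∫ ξ, h l ξ ∂μ)}, ?_, fun x hx l => ?_⟩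
  · refine measure_iUnion_le_card _ _ fun l => ?_
    refine hoeffding_pi μ (fun _ => h l) (fun _ => hm l) one_pos (fun _ ξ => ?_) ?_ (by positivity)
    · have := indicator_one_mem_unit {u | lab u = l} ξ
      rw [abs_neg, abs_of_nonneg this.1]
      exact this.2
    · simp
  · have hnot : ¬ k * δ ≤ ∑ i : Fin k, (h l (x i) - ∫ ξ, h l ξ ∂μ) := fun hh =>
      hx (Set.mem_iUnion.2 ⟨l, hh⟩)
    have hinteg : ∫ ξ, h l ξ ∂μ = - μ.real {u | lab u = l} := by
      simp only [h]
      rw [integral_neg, integral_indicator_one (hlab l)]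
    have hsum : ∑ i : Fin k, h l (x i) =
        -((Finset.univ.filter fun i => lab (x i) = l).card : ℝ) := by
      simp only [h, Finset.sum_neg_distrib, Set.indicator_apply, Set.mem_ofPred_eq, Pi.one_apply,
        Finset.sum_boole]
    rw [Finset.sum_sub_distrib, hsum, hinteg, Finset.sum_const, Finset.card_univ, Fintype.card_fin,
      nsmul_eq_mul] at hnot
    linarith

lemma exists_rectangle_event {X : Type*} [MeasurableSpace X] [Nonempty X] (μ : Measure X)
    [IsProbabilityMeasure μ] (U : X → X → ℝ) (hU : Measurable (Function.uncurry U)) {B κ lam : ℝ}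
    (hB0 : 0 < B) (hB : ∀ ξ ζ, |U ξ ζ| ≤ B)
    (hκ : ∀ S T : Set X, MeasurableSet S → MeasurableSet T →
      |∫ z in S ×ˢ T, U z.1 z.2 ∂(μ.prod μ)| ≤ κ) (hlam : 0 < lam)
    {k p : ℕ} (hk : 0 < k) (hp : 0 < p) :
    ∃ E : Set (Fin k → X), Measure.pi (fun _ => μ) E ≤
        ENNReal.ofReal (2 * (((k : ℝ) ^ (p * p) * 2 ^ (p * p)) ^ 2 * ((k + 1) *
          Real.exp (-(k * lam) ^ 2 / (2 * (k * B ^ 2)))))) ∧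
      ∀ x ∉ E, ∀ S T : Finset (Fin k), |∑ i ∈ S, ∑ j ∈ T, U (x i) (x j)| ≤
        k ^ 2 * (κ + 2 * lam) + k * B * (8 * p ^ 2 + 2) + 4 * B * k ^ 2 / p := by
  obtain ⟨E₁, hE₁, h₁⟩ := sample_rectangle_le μ U hU hB0 hB
    (fun S T hS hT => (le_abs_self _).trans (hκ S T hS hT)) hlam hk hp
  obtain ⟨E₂, hE₂, h₂⟩ := sample_rectangle_le μ (fun u v => -U u v) hU.neg hB0
    (fun ξ ζ => by rw [abs_neg]; exact hB ξ ζ)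
    (fun S T hS hT => by rw [integral_neg]; exact (neg_le_abs _).trans (hκ S T hS hT)) hlam hk hp
  refine ⟨E₁ ∪ E₂, (measure_union_le _ _).trans ((add_le_add hE₁ hE₂).trans_eq ?_), fun x hx S T =>
    abs_le'.2 ⟨h₁ x (fun h => hx (Or.inl h)) S T, ?_⟩⟩
  · rw [← ENNReal.ofReal_add (by positivity) (by positivity), ← two_mul]
  · have := h₂ x (fun h => hx (Or.inr h)) S T
    simpa only [Finset.sum_neg_distrib] using this

lemma sum_sum_comp_perm {ι X : Type*} [DecidableEq ι] (σ : Equiv.Perm ι) (U : X → X → ℝ) (x : ι → X)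
    (S T : Finset ι) : ∑ a ∈ S, ∑ b ∈ T, U (x (σ a)) (x (σ b)) =
      ∑ i ∈ S.map σ.toEmbedding, ∑ j ∈ T.map σ.toEmbedding, U (x i) (x j) := by
  simp

lemma card_filter_comp_perm {ι : Type*} [Fintype ι] (σ : Equiv.Perm ι) (P : ι → Prop) :
    (Finset.univ.filter fun i => P (σ i)).card = (Finset.univ.filter fun i => P i).card := by
  rw [← Finset.card_map σ.toEmbedding]
  congr 1
  ext i
  simp only [Finset.mem_map, Finset.mem_filter_univ, Equiv.coe_toEmbedding]
  exact ⟨by rintro ⟨a, ha, rfl⟩; exact ha, fun h => ⟨σ.symm i, by simpa using h, by simp⟩⟩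

/-- A label function, constant on the cells of a grid, recording the strip of a point and its
membership in the sets of a step kernel. -/
lemma exists_label {m n : ℕ} [NeZero m] {S T : ℕ → Set USq} (hS : ∀ t, S t ∈ gridAlgebra)
    (hT : ∀ t, T t ∈ gridAlgebra) (c : ℕ → ℝ) :
    ∃ (lab : USq → Fin m × (Fin n → Bool × Bool)) (d : ℕ)
      (h : Fin m × (Fin n → Bool × Bool) → Fin m × (Fin n → Bool × Bool) → ℝ), 0 < d ∧
      (∀ u, (lab u).1 = cellIdx m u.1) ∧
      (∀ u v : USq, Qn d (u.1 : ℝ) = Qn d (v.1 : ℝ) → Qn d (u.2 : ℝ) = Qn d (v.2 : ℝ) →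
        lab u = lab v) ∧
      (∀ u v, stepKernel S T c n u v = h (lab u) (lab v)) ∧
      ∀ l, MeasurableSet {u | lab u = l} := by
  obtain ⟨d₁, hd₁, hg₁⟩ := exists_common_grid hS n
  obtain ⟨d₂, hd₂, hg₂⟩ := exists_common_grid hT n
  have hm : 0 < m := NeZero.pos m
  have hd : 0 < m * (d₁ * d₂) := by positivity
  let lab : USq → Fin m × (Fin n → Bool × Bool) := fun u =>
    (cellIdx m u.1, fun t => (decide (u ∈ S t), decide (u ∈ T t)))
  refine ⟨lab, m * (d₁ * d₂), fun l l' => ∑ t : Fin n, c t *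
    ((if (l.2 t).1 then 1 else 0) * (if (l'.2 t).2 then 1 else 0)), hd, fun u => rfl, ?_, ?_, ?_⟩
  · intro u v h1 h2
    refine Prod.ext (cellIdx_eq_iff.2 (Qn_eq_of_dvd hd ⟨_, rfl⟩ h1)) (funext fun t => ?_)
    refine Prod.ext ?_ ?_
    · exact decide_eq_decide.2
        ((hg₁ t t.2).of_dvd hd ((Dvd.intro _ rfl).mul_left m) u v h1 h2)
    · exact decide_eq_decide.2
        ((hg₂ t t.2).of_dvd hd ((Dvd.intro_left _ rfl).mul_left m) u v h1 h2)
  · intro u v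
    rw [stepKernel, Finset.sum_range]
    simp [lab, Set.indicator_apply]
  · intro l
    have hset : {u | lab u = l} = {u | cellIdx m u.1 = l.1} ∩
        ⋂ t : Fin n, ({u | decide (u ∈ S t) = (l.2 t).1} ∩ {u | decide (u ∈ T t) = (l.2 t).2}) := by
      ext u
      simp [lab, Prod.ext_iff, funext_iff]
    have hdec : ∀ {A : Set USq}, MeasurableSet A → ∀ b, MeasurableSet {u | decide (u ∈ A) = b} := by
      intro A hA b
      cases b
      · have hc : {u | decide (u ∈ A) = false} = Aᶜ := by
          ext u
          simp
        rw [hc]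
        exact hA.compl
      · simpa using hA
    rw [hset]
    refine MeasurableSet.inter ?_ (MeasurableSet.iInter fun t => (hdec (hS t).1 _).inter
      (hdec (hT t).1 _))
    exact ((measurable_cellIdx m).comp measurable_fst) (measurableSet_singleton l.1)

lemma abs_sum_diag_le {k : ℕ} (D : Fin k → Fin k → ℝ) (hD : ∀ a, |D a a| ≤ 1)
    (S T : Finset (Fin k)) : |∑ a ∈ S, ∑ b ∈ T, if a = b then D a b else 0| ≤ k := by
  simp only [Finset.sum_ite_eq]
  refine (Finset.abs_sum_le_sum_abs _ _).trans ?_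
  calc ∑ a ∈ S, |if a ∈ T then D a a else 0| ≤ ∑ _a ∈ S, (1 : ℝ) := by
        refine Finset.sum_le_sum fun a _ => ?_
        split_ifs
        · exact hD a
        · simp
    _ ≤ k := by
        rw [Finset.sum_const, nsmul_eq_mul, mul_one]
        exact_mod_cast (Finset.card_le_univ S).trans_eq (Fintype.card_fin k)

/-- Sampling with explicit parameters. -/
lemma exists_sampling_event {k m : ℕ} (hk : 0 < k) (hm : 0 < m) {W : USq → USq → ℝ}
    (hW : IsOrderon W) {δ : ℝ} (hδ : 0 < δ) {b : ℝ} (hb : b = ((m ^ 2 + 1 : ℕ) : ℝ) * (1 / m)) :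
    ∃ E : Set ((Fin k → UI) × (Fin k → UI) × (Pairs k → UI)),
      volume E ≤ ENNReal.ofReal (
        (m * 4 ^ (m ^ 2 + 1)) * Real.exp (-(k * δ) ^ 2 / (2 * (k * 1 ^ 2)))
        + 2 * (((k : ℝ) ^ (m ^ 2 * m ^ 2) * 2 ^ (m ^ 2 * m ^ 2)) ^ 2 * ((k + 1) *
          Real.exp (-(k * (1 / m)) ^ 2 / (2 * (k * (1 + b) ^ 2)))))
        + (k : ℝ) ^ k * (2 * 4 ^ k) *
          Real.exp (-((k : ℝ) ^ 2 / m) ^ 2 / (2 * ((k : ℝ) ^ 2 * 2 ^ 2)))) ∧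
      ∀ p ∉ E, csDist W (graphOrderon (sampleSG k W p.1 p.2.1 p.2.2)) ≤
        1 / m + (1 / m + 4 * b * ((m + 1) * (m * 4 ^ (m ^ 2 + 1) * δ)) +
          (3 / m + (1 + b) * (8 * ((m : ℝ) ^ 2) ^ 2 + 2) / k + 4 * (1 + b) / (m : ℝ) ^ 2
            + 1 / m + 1 / k)) := by
  have : NeZero m := ⟨hm.ne'⟩
  have : NeZero k := ⟨hk.ne'⟩
  have hm' : (0 : ℝ) < m := Nat.cast_pos.2 hm
  have hk' : (0 : ℝ) < k := Nat.cast_pos.2 hk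
  have hWm := hW.1
  have hW1 : ∀ u v, |W u v| ≤ 1 := fun u v => by
    rw [abs_of_nonneg (hW.2.1 u v).1]
    exact (hW.2.1 u v).2
  obtain ⟨S₀, T₀, c, hS₀, hT₀, hc, hcut⟩ :=
    exists_stepKernel_approx (volume : Measure USq) measureDense_gridAlgebra W hWm hW1 hm
  set H := stepKernel S₀ T₀ c (m ^ 2 + 1) with hH
  have hHb : ∀ u v, |H u v| ≤ b := fun u v => hb ▸ abs_stepKernel_le hc (m ^ 2 + 1) u v
  have hb0 : 0 ≤ b := by rw [hb]; positivity
  have hHm : Measurable (Function.uncurry H) :=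
    measurable_stepKernel (fun t => (hS₀ t).1) (fun t => (hT₀ t).1) _
  obtain ⟨lab, d, h, hd, hlab1, hlabd, hHh, hlabm⟩ := exists_label (m := m) (n := m ^ 2 + 1) hS₀ hT₀ c
  have hcard : (Fintype.card (Fin m × (Fin (m ^ 2 + 1) → Bool × Bool)) : ℝ) =
      m * 4 ^ (m ^ 2 + 1) := by
    simp
  obtain ⟨E₁, hE₁, h₁⟩ := exists_label_event (volume : Measure USq) lab hlabm hk hδ
  obtain ⟨E₂, hE₂, h₂⟩ := exists_rectangle_event (volume : Measure USq) (fun u v => W u v - H u v)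
    (hWm.sub hHm) (B := 1 + b) (by positivity)
    (fun u v => (abs_sub _ _).trans (add_le_add (hW1 u v) (hHb u v))) hcut
    (lam := 1 / m) (by positivity) hk (p := m ^ 2) (by positivity)
  obtain ⟨E₃, hE₃, h₃⟩ := exists_edge_event (k := k) hW (t := (k : ℝ) ^ 2 / m) (by positivity)
  let pts : (Fin k → UI) × (Fin k → UI) × (Pairs k → UI) → Fin k → USq :=
    fun p i => (p.1 i, p.2.1 i)
  have hpts : MeasurePreserving pts volume volume := measurePreserving_points k
  refine ⟨pts ⁻¹' E₁ ∪ pts ⁻¹' E₂ ∪ E₃, ?_, fun p hp => ?_⟩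
  · rw [hcard] at hE₁
    have e1 := (measure_preimage_le_of_measurePreserving hpts E₁).trans hE₁
    have e2 := (measure_preimage_le_of_measurePreserving hpts E₂).trans hE₂
    rw [ENNReal.ofReal_add (by positivity) (by positivity),
      ENNReal.ofReal_add (by positivity) (by positivity)]
    exact (measure_union_le _ _).trans (add_le_add
      ((measure_union_le _ _).trans (add_le_add e1 e2)) hE₃)
  have hp1 : pts p ∉ E₁ := fun hh => hp (Or.inl (Or.inl hh))
  have hp2 : pts p ∉ E₂ := fun hh => hp (Or.inl (Or.inr hh))
  have hp3 : p ∉ E₃ := fun hh => hp (Or.inr hh)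
  set σ := Tuple.sort (fun t => (p.1 t : ℝ)) with hσ
  set G := sampleSG k W p.1 p.2.1 p.2.2 with hG
  have hsort : Monotone fun a => ((pts p (σ a)).1 : UI) := fun a a' haa =>
    Tuple.monotone_sort (fun t => (p.1 t : ℝ)) haa
  have hedge := h₃ p hp3
  have hdist := csDist_graphOrderon_le (s := m) hd hWm hW1 lab Prod.fst hlab1 hlabd
    (fun l l' => max (-b) (min b (h l l'))) (b := b) (ε := 1 / m)
    (fun l l' => abs_le.2 ⟨le_max_left _ _, max_le (by linarith) (min_le_left _ _)⟩)
    (fun A B hA hB => by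
      have e : ∀ z : USq × USq, max (-b) (min b (h (lab z.1) (lab z.2))) = H z.1 z.2 := fun z => by
        rw [← hHh, ← hH, min_eq_right (abs_le.1 (hHb _ _)).2, max_eq_right (abs_le.1 (hHb _ _)).1]
      simp only [e]
      exact hcut A B hA hB) (fun a => pts p (σ a)) hsort G (δ := δ)
    (fun l => by
      rw [card_filter_comp_perm σ fun i => lab (pts p i) = l]
      exact h₁ _ hp1 l) hδ.le
    (κ := 3 / m + (1 + b) * (8 * ((m : ℝ) ^ 2) ^ 2 + 2) / k + 4 * (1 + b) / (m : ℝ) ^ 2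
            + 1 / m + 1 / k) (fun S T => by
      have e : ∀ a a', max (-b) (min b (h (lab (pts p (σ a))) (lab (pts p (σ a'))))) =
          H (pts p (σ a)) (pts p (σ a')) := fun a a' => by
        rw [← hHh, ← hH, min_eq_right (abs_le.1 (hHb _ _)).2, max_eq_right (abs_le.1 (hHb _ _)).1]
      simp only [e]
      let U : USq → USq → ℝ := fun u v => W u v - H u v
      have e2 : ∑ a ∈ S, ∑ a' ∈ T, (H (pts p (σ a)) (pts p (σ a')) - if G.Adj a a' then 1 else 0) =
          -(∑ a ∈ S, ∑ a' ∈ T, U (pts p (σ a)) (pts p (σ a'))) +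
          (∑ a ∈ S, ∑ a' ∈ T, if a = a' then 0 else
            (W (pts p (σ a)) (pts p (σ a')) - if G.Adj a a' then 1 else 0)) +
          ∑ a ∈ S, ∑ a' ∈ T, if a = a' then W (pts p (σ a)) (pts p (σ a')) else 0 := by
        rw [← Finset.sum_neg_distrib, ← Finset.sum_add_distrib, ← Finset.sum_add_distrib]
        refine Finset.sum_congr rfl fun a _ => ?_
        rw [← Finset.sum_neg_distrib, ← Finset.sum_add_distrib, ← Finset.sum_add_distrib]
        refine Finset.sum_congr rfl fun a' _ => ?_
        by_cases haa : a = a'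
        · subst haa
          simp [U]
        · simp only [U, if_neg haa]
          ring
      rw [e2]
      have f1 := h₂ _ hp2 (S.map σ.toEmbedding) (T.map σ.toEmbedding)
      rw [← sum_sum_comp_perm σ (fun u v => W u v - H u v) (pts p) S T] at f1
      have f2 := hedge S T
      have f3 := abs_sum_diag_le (fun a a' => W (pts p (σ a)) (pts p (σ a'))) (fun a => hW1 _ _) S T
      refine ((abs_add_le _ _).trans (add_le_add ((abs_add_le _ _).trans (add_le_add
        ((abs_neg _).trans_le f1) f2)) f3)).trans_eq ?_
      push_cast
      field_simp
      ring)
  rw [hcard] at hdist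
  exact hdist

lemma add_two_le_four_pow (m : ℕ) : m + 2 ≤ 4 ^ (m ^ 2 + 1) := by
  have h1 : m ^ 2 + 1 < 4 ^ (m ^ 2 + 1) := Nat.lt_pow_self (by norm_num)
  have h2 : m ≤ m ^ 2 := Nat.le_self_pow two_ne_zero m
  omega

lemma sixteen_le_four_pow {m : ℕ} (hm : 0 < m) : 16 ≤ 4 ^ (m ^ 2 + 1) := by
  have h : 2 ≤ m ^ 2 + 1 := by nlinarith
  calc 16 = 4 ^ 2 := by norm_num
    _ ≤ 4 ^ (m ^ 2 + 1) := Nat.pow_le_pow_right (by norm_num) h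

lemma sampling_distance_bound {k m w b : ℝ} (hm : 1 ≤ m) (hw : 16 ≤ w) (hmw : m + 2 ≤ w)
    (hk : w ^ 32 ≤ k) (hb0 : 0 ≤ b) (hb : b ≤ m + 1) :
    1 / m + (1 / m + 4 * b * ((m + 1) * (m * w * (1 / w ^ 6))) +
          (3 / m + (1 + b) * (8 * (m ^ 2) ^ 2 + 2) / k + 4 * (1 + b) / m ^ 2
            + 1 / m + 1 / k)) ≤ 21 / m := by
  have hw0 : 0 < w := by linarith
  have hm0 : 0 < m := by linarith
  have hk0 : 0 < k := lt_of_lt_of_le (by positivity) hk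
  have hw1 : 1 ≤ w := by linarith
  have hmw' : m ≤ w := by linarith
  have h1 : 4 * b * ((m + 1) * (m * w * (1 / w ^ 6))) ≤ 1 / m := by
    have : 4 * b * ((m + 1) * (m * w)) * m ≤ w ^ 6 := by
      calc 4 * b * ((m + 1) * (m * w)) * m ≤ w * w * (w * (w * w)) * w := by
            gcongr <;> linarith
        _ = w ^ 6 := by ring
    rw [le_div_iff₀ hm0]
    calc _ = (4 * b * ((m + 1) * (m * w)) * m) / w ^ 6 := by ring
      _ ≤ 1 := div_le_one_of_le₀ this (by positivity)
  have h2 : (1 + b) * (8 * (m ^ 2) ^ 2 + 2) / k ≤ 1 / m := by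
    rw [div_le_div_iff₀ hk0 hm0, one_mul]
    have h3 : 8 * (m ^ 2) ^ 2 + 2 ≤ w ^ 5 := by
      have e : m ^ 4 ≤ w ^ 4 := by gcongr
      have e2 : 1 ≤ w ^ 4 := one_le_pow₀ hw1
      have e3 : w ^ 4 * 16 ≤ w ^ 4 * w := by gcongr
      calc _ = 8 * m ^ 4 + 2 := by ring
        _ ≤ w ^ 4 * 16 := by linarith
        _ ≤ w ^ 5 := by linarith [pow_succ w 4]
    calc (1 + b) * (8 * (m ^ 2) ^ 2 + 2) * m ≤ w * w ^ 5 * w := by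
          gcongr; linarith
      _ = w ^ 7 := by ring
      _ ≤ w ^ 32 := pow_le_pow_right₀ hw1 (by norm_num)
      _ ≤ k := hk
  have h4 : 4 * (1 + b) / m ^ 2 ≤ 12 / m := by
    rw [div_le_div_iff₀ (by positivity) hm0]
    nlinarith
  have h5 : 1 / k ≤ 1 / m := by
    gcongr
    exact hmw'.trans ((le_self_pow₀ hw1 (by norm_num)).trans hk)
  calc _ ≤ 1 / m + (1 / m + 1 / m + (3 / m + 1 / m + 12 / m + 1 / m + 1 / m)) := by gcongr
    _ = 21 / m := by ring

lemma label_probability_bound {m w q : ℝ} (hw : 16 ≤ w) (hmw : m ≤ w)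
    (hq : w ^ 16 ≤ q) :
    (m * w) * Real.exp (-(q ^ 2 * (1 / w ^ 6)) ^ 2 / (2 * (q ^ 2 * 1 ^ 2))) ≤ Real.exp (-q) := by
  have hw0 : 0 < w := by linarith
  have hw1 : 1 ≤ w := by linarith
  have hq0 : 0 < q := lt_of_lt_of_le (by positivity) hq
  have h1 : m * w ≤ Real.exp q := by
    calc m * w ≤ w * w := by gcongr
      _ = w ^ 2 := by ring
      _ ≤ w ^ 16 := pow_le_pow_right₀ hw1 (by norm_num)
      _ ≤ q := hq
      _ ≤ Real.exp q := by linarith [Real.add_one_le_exp q]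
  have h2 : -(q ^ 2 * (1 / w ^ 6)) ^ 2 / (2 * (q ^ 2 * 1 ^ 2)) ≤ -q + -q := by
    have e : (q ^ 2 * (1 / w ^ 6)) ^ 2 / (2 * (q ^ 2 * 1 ^ 2)) = q * (q / (2 * w ^ 12)) := by
      field_simp
    have e2 : 2 ≤ q / (2 * w ^ 12) := by
      rw [le_div_iff₀ (by positivity)]
      calc 2 * (2 * w ^ 12) = 4 * w ^ 12 := by ring
        _ ≤ w ^ 4 * w ^ 12 := by
          gcongr
          exact (by linarith : (4 : ℝ) ≤ w).trans (le_self_pow₀ hw1 (by norm_num))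
        _ = w ^ 16 := by ring
        _ ≤ q := hq
    rw [neg_div, e]
    nlinarith
  calc _ ≤ Real.exp q * Real.exp (-q + -q) := by gcongr
    _ = Real.exp (-q) := by rw [← Real.exp_add]; ring_nf

lemma two_le_exp_one : (2 : ℝ) ≤ Real.exp 1 := by
  linarith [Real.add_one_le_exp (1 : ℝ)]

lemma pow_le_exp_mul {x y : ℝ} (hx : 0 ≤ x) (h : x ≤ Real.exp y) (n : ℕ) :
    x ^ n ≤ Real.exp (n * y) := by
  rw [Real.exp_nat_mul]
  exact pow_le_pow_left₀ hx h n

lemma rectangle_probability_bound {m : ℕ} {w b q : ℝ} (hm : 1 ≤ m) (hw : 16 ≤ w)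
    (hmw : (m : ℝ) + 2 ≤ w) (hq : w ^ 16 ≤ q) (hb0 : 0 ≤ b) (hb : b ≤ m + 1)
    (hlog : q ^ 2 ≤ Real.exp ((m : ℝ) ^ 3)) :
    2 * (((q ^ 2) ^ (m ^ 2 * m ^ 2) * 2 ^ (m ^ 2 * m ^ 2)) ^ 2 * ((q ^ 2 + 1) *
          Real.exp (-(q ^ 2 * (1 / m)) ^ 2 / (2 * (q ^ 2 * (1 + b) ^ 2))))) ≤ Real.exp (-q) := by
  have hw0 : 0 < w := by linarith
  have hw1 : 1 ≤ w := by linarith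
  have hm' : (1 : ℝ) ≤ m := by exact_mod_cast hm
  have hq0 : 0 < q := lt_of_lt_of_le (by positivity) hq
  have hq1 : 1 ≤ q := (one_le_pow₀ hw1).trans hq
  set M : ℝ := (m : ℝ) with hM
  have hMw : M ≤ w := by linarith
  have h1 : (q ^ 2) ^ (m ^ 2 * m ^ 2) ≤ Real.exp (M ^ 4 * M ^ 3) := by
    refine (pow_le_exp_mul (by positivity) hlog _).trans_eq ?_
    push_cast
    rw [← hM]
    ring_nf
  have h2 : (2 : ℝ) ^ (m ^ 2 * m ^ 2) ≤ Real.exp (M ^ 4 * 1) := by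
    refine (pow_le_exp_mul two_pos.le two_le_exp_one _).trans_eq ?_
    push_cast
    rw [← hM]
    ring_nf
  have h3 : q ^ 2 + 1 ≤ Real.exp 1 * Real.exp (M ^ 3) := by
    calc q ^ 2 + 1 ≤ 2 * q ^ 2 := by nlinarith
      _ ≤ Real.exp 1 * Real.exp (M ^ 3) := by gcongr; exact two_le_exp_one
  have h4 : -(q ^ 2 * (1 / M)) ^ 2 / (2 * (q ^ 2 * (1 + b) ^ 2)) ≤ -(4 * q) := by
    have e : (q ^ 2 * (1 / M)) ^ 2 / (2 * (q ^ 2 * (1 + b) ^ 2)) =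
        q * (q / (2 * M ^ 2 * (1 + b) ^ 2)) := by
      field_simp
    have e2 : 4 ≤ q / (2 * M ^ 2 * (1 + b) ^ 2) := by
      rw [le_div_iff₀ (by positivity)]
      calc 4 * (2 * M ^ 2 * (1 + b) ^ 2) = 8 * M ^ 2 * (1 + b) ^ 2 := by ring
        _ ≤ w * w ^ 2 * w ^ 2 := by gcongr <;> linarith
        _ = w ^ 5 := by ring
        _ ≤ w ^ 16 := pow_le_pow_right₀ hw1 (by norm_num)
        _ ≤ q := hq
    rw [neg_div, e]
    nlinarith
  have h5 : 2 * (M ^ 4 * M ^ 3 + M ^ 4 * 1) ≤ q := by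
    calc 2 * (M ^ 4 * M ^ 3 + M ^ 4 * 1) ≤ 2 * (w ^ 4 * w ^ 3 + w ^ 4 * w ^ 3) := by
          gcongr
          exact one_le_pow₀ hw1
      _ = 4 * w ^ 7 := by ring
      _ ≤ w ^ 9 * w ^ 7 := by
          gcongr
          exact (by linarith : (4 : ℝ) ≤ w).trans (le_self_pow₀ hw1 (by norm_num))
      _ = w ^ 16 := by ring
      _ ≤ q := hq
  have h6 : 2 + M ^ 3 ≤ q := by
    calc 2 + M ^ 3 ≤ w ^ 3 + w ^ 3 := by
          gcongr
          exact (by linarith : (2 : ℝ) ≤ w).trans (le_self_pow₀ hw1 (by norm_num))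
      _ = 2 * w ^ 3 := by ring
      _ ≤ w ^ 13 * w ^ 3 := by
          gcongr
          exact (by linarith : (2 : ℝ) ≤ w).trans (le_self_pow₀ hw1 (by norm_num))
      _ = w ^ 16 := by ring
      _ ≤ q := hq
  calc _ ≤ Real.exp 1 * ((Real.exp (M ^ 4 * M ^ 3) * Real.exp (M ^ 4 * 1)) ^ 2 *
        ((Real.exp 1 * Real.exp (M ^ 3)) * Real.exp (-(4 * q)))) := by
        gcongr
        exact two_le_exp_one
    _ = Real.exp (2 * (M ^ 4 * M ^ 3 + M ^ 4 * 1) + (2 + M ^ 3) - 4 * q) := by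
        rw [← Real.exp_add, ← Real.exp_nat_mul, ← Real.exp_add, ← Real.exp_add, ← Real.exp_add,
          ← Real.exp_add]
        congr 1
        push_cast
        ring
    _ ≤ Real.exp (-q) := Real.exp_le_exp.2 (by linarith)

lemma edge_probability_bound {k : ℕ} {m w q : ℝ} (hm : 1 ≤ m) (hw : 16 ≤ w) (hmw : m ≤ w)
    (hk : w ^ 32 ≤ k) (hq : q ≤ k) (hlog : (k : ℝ) ≤ Real.exp (m ^ 3)) :
    (k : ℝ) ^ k * (2 * 4 ^ k) *
          Real.exp (-((k : ℝ) ^ 2 / m) ^ 2 / (2 * ((k : ℝ) ^ 2 * 2 ^ 2))) ≤ Real.exp (-q) := by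
  have hw0 : 0 < w := by linarith
  have hw1 : 1 ≤ w := by linarith
  have hm0 : 0 < m := by linarith
  have hk0 : (0 : ℝ) < k := lt_of_lt_of_le (by positivity) hk
  have hk1 : (1 : ℝ) ≤ k := (one_le_pow₀ hw1).trans hk
  have h1 := pow_le_exp_mul hk0.le hlog k
  have h2 : (4 : ℝ) ^ k ≤ Real.exp (k * 2) := by
    refine pow_le_exp_mul (by norm_num) ?_ k
    calc (4 : ℝ) = 2 * 2 := by norm_num
      _ ≤ Real.exp 1 * Real.exp 1 := by gcongr <;> exact two_le_exp_one
      _ = Real.exp 2 := by rw [← Real.exp_add]; norm_num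
  have h3 : -((k : ℝ) ^ 2 / m) ^ 2 / (2 * ((k : ℝ) ^ 2 * 2 ^ 2)) ≤ -(k * (m ^ 3 + 4)) := by
    have e : ((k : ℝ) ^ 2 / m) ^ 2 / (2 * ((k : ℝ) ^ 2 * 2 ^ 2)) = k * (k / (8 * m ^ 2)) := by
      field_simp
      norm_num
    have e2 : m ^ 3 + 4 ≤ k / (8 * m ^ 2) := by
      rw [le_div_iff₀ (by positivity)]
      calc (m ^ 3 + 4) * (8 * m ^ 2) ≤ (w ^ 3 + w ^ 3) * (w * w ^ 2) := by
            gcongr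
            · exact (by linarith : (4 : ℝ) ≤ w).trans (le_self_pow₀ hw1 (by norm_num))
            · linarith
        _ = 2 * w ^ 6 := by ring
        _ ≤ w ^ 26 * w ^ 6 := by
            gcongr
            exact (by linarith : (2 : ℝ) ≤ w).trans (le_self_pow₀ hw1 (by norm_num))
        _ = w ^ 32 := by ring
        _ ≤ k := hk
    rw [neg_div, e]
    have := mul_le_mul_of_nonneg_left e2 hk0.le
    linarith
  calc _ ≤ Real.exp (k * m ^ 3) * (Real.exp 1 * Real.exp (k * 2)) *
        Real.exp (-(k * (m ^ 3 + 4))) := by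
        gcongr
        exact two_le_exp_one
    _ = Real.exp (1 - 2 * k) := by
        rw [← Real.exp_add, ← Real.exp_add, ← Real.exp_add]
        congr 1
        ring
    _ ≤ Real.exp (-q) := Real.exp_le_exp.2 (by linarith)

lemma exists_scale {k : ℕ} (hk : (128 : ℝ) ^ 3 ≤ Real.log k) :
    ∃ m : ℕ, 1 ≤ m ∧ Real.log k ≤ (m : ℝ) ^ 3 ∧ ((4 : ℝ) ^ (m ^ 2 + 1)) ^ 32 ≤ k ∧
      1 / (m : ℝ) ≤ (Real.log (Real.log k) / Real.log k) ^ ((1 : ℝ) / 3) := by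
  set ℓ := Real.log k with hℓ
  have hℓ0 : 0 < ℓ := lt_of_lt_of_le (by norm_num) hk
  have hk0 : (0 : ℝ) < k := by
    rcases Nat.eq_zero_or_pos k with h | h
    · simp [hℓ, h] at hℓ0
    · exact_mod_cast h
  set L := ℓ ^ ((1 : ℝ) / 3) with hL
  have hL3 : L ^ 3 = ℓ := by
    rw [hL, ← Real.rpow_natCast, ← Real.rpow_mul hℓ0.le]
    norm_num
  have hL0 : 0 < L := Real.rpow_pos_of_pos hℓ0 _
  have hL128 : 128 ≤ L := le_of_pow_le_pow_left₀ three_ne_zero hL0.le (by rw [hL3]; exact hk)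
  have hmL : L ≤ ⌈L⌉₊ := Nat.le_ceil L
  have hmL' : (⌈L⌉₊ : ℝ) < L + 1 := Nat.ceil_lt_add_one hL0.le
  have hm0 : (0 : ℝ) < ⌈L⌉₊ := hL0.trans_le hmL
  refine ⟨⌈L⌉₊, Nat.ceil_pos.2 hL0, ?_, ?_, ?_⟩
  · rw [← hL3]
    gcongr
  · have h4 : (4 : ℝ) ≤ Real.exp 2 := by
      calc (4 : ℝ) = 2 * 2 := by norm_num
        _ ≤ Real.exp 1 * Real.exp 1 := by gcongr <;> exact two_le_exp_one
        _ = Real.exp 2 := by rw [← Real.exp_add]; norm_num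
    rw [← pow_mul]
    refine (pow_le_exp_mul (by norm_num) h4 _).trans ?_
    rw [← Real.exp_log hk0, ← hℓ, ← hL3]
    refine Real.exp_le_exp.2 ?_
    push_cast
    have e1 : (⌈L⌉₊ : ℝ) ^ 2 ≤ (L + 1) ^ 2 := by gcongr
    have e2 : L * L * 128 ≤ L * L * L := by gcongr
    nlinarith
  · have hll : 1 ≤ Real.log ℓ := by
      rw [Real.le_log_iff_exp_le hℓ0]
      linarith [Real.exp_one_lt_d9]
    calc 1 / (⌈L⌉₊ : ℝ) ≤ 1 / L := by gcongr
      _ = (1 / ℓ) ^ ((1 : ℝ) / 3) := by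
          rw [hL, Real.div_rpow one_pos.le hℓ0.le, Real.one_rpow]
      _ ≤ _ := by gcongr

/-- Sampling theorem: there is `C > 0` such that for every `k ≥ 3` and every orderon `W`,
the set of sample points `(z,y,r)` for which the sampled ordered graph `G(z,y,r;W)` on
`k` vertices satisfies `d△(W, W_{G(z,y,r;W)}) > C·(log log k / log k)^{1/3}` has measure
at most `C·exp(-√k/C)`. -/
theorem sampling_theorem :
    ∃ C : ℝ, 0 < C ∧ ∀ k : ℕ, 3 ≤ k → ∀ W : USq → USq → ℝ, IsOrderon W →
      volume {p : (Fin k → UI) × (Fin k → UI) × (Pairs k → UI) |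
          C * ((Real.log (Real.log k) / Real.log k) ^ ((1:ℝ)/3)) <
            csDist W (graphOrderon (sampleSG k W p.1 p.2.1 p.2.2))} ≤
        ENNReal.ofReal (C * Real.exp (-Real.sqrt k / C)) := by
  refine ⟨Real.exp (128 ^ 3) + 21, by positivity, fun k hk W hW => ?_⟩
  set C : ℝ := Real.exp (128 ^ 3) + 21 with hC
  have hC21 : 21 ≤ C := by linarith [Real.exp_pos (128 ^ 3)]
  have hk0 : 0 < k := by omega
  have hk' : (0 : ℝ) < k := Nat.cast_pos.2 hk0
  have hk1 : (1 : ℝ) ≤ k := by exact_mod_cast hk0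
  have hsqrt : Real.sqrt k ≤ k := Real.sqrt_le_iff.2 ⟨hk'.le, by nlinarith⟩
  rcases lt_or_ge (Real.log k) (128 ^ 3) with hsmall | hlarge
  · refine prob_le_one.trans (ENNReal.one_le_ofReal.2 ?_)
    have h1 : (k : ℝ) ≤ C := by
      rw [Real.log_lt_iff_lt_exp hk'] at hsmall
      linarith
    have h2 : Real.exp (-1) ≤ Real.exp (-Real.sqrt k / C) := by
      refine Real.exp_le_exp.2 ?_
      rw [neg_div, neg_le_neg_iff]
      exact div_le_one_of_le₀ (hsqrt.trans h1) (by linarith)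
    have h3 : 1 / 21 ≤ Real.exp (-1) := by
      rw [Real.exp_neg, ← one_div]
      gcongr
      linarith [Real.exp_one_lt_d9]
    nlinarith
  obtain ⟨m, hm, hlog, hw, hθ⟩ := exists_scale hlarge
  set w : ℝ := 4 ^ (m ^ 2 + 1) with hwdef
  have hm' : (1 : ℝ) ≤ m := by exact_mod_cast hm
  have hw16 : 16 ≤ w := by rw [hwdef]; exact_mod_cast sixteen_le_four_pow hm
  have hmw : (m : ℝ) + 2 ≤ w := by rw [hwdef]; exact_mod_cast add_two_le_four_pow m
  have hw0 : 0 < w := by positivity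
  obtain ⟨b, hb⟩ : ∃ b : ℝ, b = ((m ^ 2 + 1 : ℕ) : ℝ) * (1 / m) := ⟨_, rfl⟩
  have hb0 : 0 ≤ b := by rw [hb]; positivity
  have hb1 : b ≤ m + 1 := by
    rw [hb, mul_one_div, div_le_iff₀ (by positivity)]
    push_cast
    nlinarith
  obtain ⟨E, hE, hdist⟩ := exists_sampling_event hk0 hm hW (δ := 1 / w ^ 6) (by positivity) hb
  have hexp : (k : ℝ) ≤ Real.exp ((m : ℝ) ^ 3) := (Real.log_le_iff_le_exp hk').1 hlog
  have hq2 : Real.sqrt k ^ 2 = k := Real.sq_sqrt hk'.le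
  have hq : w ^ 16 ≤ Real.sqrt k := Real.le_sqrt_of_sq_le (by rw [← pow_mul]; exact hw)
  refine (measure_mono fun p hp => ?_ : _ ≤ volume E).trans
    (hE.trans (ENNReal.ofReal_le_ofReal ?_))
  · by_contra hpE
    have h1 := (hdist p hpE).trans (sampling_distance_bound hm' hw16 hmw hw hb0 hb1)
    have h2 : 21 / (m : ℝ) ≤
        C * ((Real.log (Real.log k) / Real.log k) ^ ((1 : ℝ) / 3)) := by
      rw [div_eq_mul_one_div]
      gcongr
    exact absurd (lt_of_lt_of_le hp (h1.trans h2)) (lt_irrefl _)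
  · have p1 := label_probability_bound hw16 (by linarith : (m : ℝ) ≤ w) hq
    have p2 := rectangle_probability_bound hm hw16 hmw hq hb0 hb1 (by rw [hq2]; exact hexp)
    have p3 := edge_probability_bound hm' hw16 (by linarith) hw hsqrt hexp
    rw [hq2] at p1 p2
    refine (add_le_add (add_le_add p1 p2) p3).trans ?_
    have h1 : Real.exp (-Real.sqrt k) ≤ Real.exp (-Real.sqrt k / C) := by
      refine Real.exp_le_exp.2 ?_
      rw [neg_div, neg_le_neg_iff]
      exact div_le_self (Real.sqrt_nonneg _) (by linarith)
    have h2 := Real.exp_pos (-Real.sqrt k / C)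
    nlinarith
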